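/- arXiv:math/0605564 — 10 statements merged into one kernel-verified Lean document; each statement's English description precedes it below -/
import Mathlib

section
/- Let 𝓕 = (F_1,…,F_k) be a finite family of nonempty subsets of [r] and let c = (c_1,…,c_r) ∈ ℝ^r satisfy c_1 < c_2 < ⋯ < c_r. Then the linear functional x ↦ Σ_i c_i x_i attains its maximum over P_𝓕 at the unique point v ∈ ℝ^r whose i-th coordinate v_i equals the number of indices j ∈ [k] such that i is the largest element of F_j. -/
open Pointwise

/-- The standard basis vector `e i` in `ℝ^r`. -/
noncomputable def eVec (r : ℕ) (i : Fin r) : Fin r → ℝ := Pi.single i 1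

/-- The standard simplex `Δ_F ⊆ ℝ^r` supported on a subset `F` of the coordinates. -/
def simpl {r : ℕ} (F : Finset (Fin r)) : Set (Fin r → ℝ) :=
  {x | (∀ i, 0 ≤ x i) ∧ (∀ i, i ∉ F → x i = 0) ∧ ∑ i, x i = 1}

/-- The Minkowski sum `P_𝓕 = Δ_{F 0} + ⋯ + Δ_{F (k-1)}`. -/
noncomputable def mink {r k : ℕ} (F : Fin k → Finset (Fin r)) : Set (Fin r → ℝ) :=
  ∑ j : Fin k, simpl (F j)

/-- `[u,v]` is an edge of `P`: `u ≠ v` are vertices (extreme points) of `P` and the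
segment `[u,v]` is an extreme subset (face) of `P`. -/
def IsEdgeOf {r : ℕ} (P : Set (Fin r → ℝ)) (u v : Fin r → ℝ) : Prop :=
  u ≠ v ∧ u ∈ Set.extremePoints ℝ P ∧ v ∈ Set.extremePoints ℝ P ∧
    IsExtreme ℝ P (segment ℝ u v)

/-- The degree of a vertex `u` of `P`: the number of `v` with `[u,v]` an edge of `P`. -/
noncomputable def polyDeg {r : ℕ} (P : Set (Fin r → ℝ)) (u : Fin r → ℝ) : ℕ :=
  {v | IsEdgeOf P u v}.ncard

/-- The number of edges of `P`, counted as segments. -/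
noncomputable def numEdgesOf {r : ℕ} (P : Set (Fin r → ℝ)) : ℕ :=
  {s : Set (Fin r → ℝ) | ∃ u v, IsEdgeOf P u v ∧ s = segment ℝ u v}.ncard

/-- The point `u(f) = e_{f 0} + ⋯ + e_{f (k-1)}` associated to a rep-function `f`. -/
noncomputable def urep {r k : ℕ} (f : Fin k → Fin r) : Fin r → ℝ :=
  ∑ j, eVec r (f j)

/-- On a simplex the functional is at most its value at the largest vertex. -/
lemma simpl_le {r : ℕ} (F : Finset (Fin r)) (hF : F.Nonempty) (c : Fin r → ℝ)
    (hc : StrictMono c) (x : Fin r → ℝ) (hx : x ∈ simpl F) :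
    ∑ i, c i * x i ≤ c (F.max' hF) ∧
      (x ≠ eVec r (F.max' hF) → ∑ i, c i * x i < c (F.max' hF)) := by
  obtain ⟨h0, h1, h2⟩ := hx
  have key : c (F.max' hF) = ∑ i, c (F.max' hF) * x i := by
    rw [← Finset.mul_sum, h2, mul_one]
  have hle : ∀ i ∈ Finset.univ, c i * x i ≤ c (F.max' hF) * x i := by
    intro i _
    by_cases hi : i ∈ F
    · exact mul_le_mul_of_nonneg_right (hc.monotone (F.le_max' i hi)) (h0 i)
    · simp [h1 i hi]
  refine ⟨by rw [key]; exact Finset.sum_le_sum hle, fun hne => ?_⟩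
  by_contra hcon
  apply hne
  have heq : ∑ i, c i * x i = ∑ i, c (F.max' hF) * x i :=
    le_antisymm (Finset.sum_le_sum hle) (by rw [← key]; exact not_lt.mp hcon)
  have hall := (Finset.sum_eq_sum_iff_of_le hle).1 heq
  have hz : ∀ i, i ≠ F.max' hF → x i = 0 := by
    intro i hi
    by_cases hiF : i ∈ F
    · have hlt : c i < c (F.max' hF) := hc (lt_of_le_of_ne (F.le_max' i hiF) hi)
      have := hall i (Finset.mem_univ i)
      by_contra hxi
      exact hlt.ne (mul_right_cancel₀ hxi this)
    · exact h1 i hiF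
  have hm : x (F.max' hF) = 1 := by
    rw [← h2]
    exact (Finset.sum_eq_single _ (fun b _ hb => hz b hb) (by simp)).symm
  funext i
  by_cases hi : i = F.max' hF
  · rw [hi, hm]; simp [eVec]
  · rw [hz i hi]; simp [eVec, hi]

lemma eVec_mem_simpl {r : ℕ} (F : Finset (Fin r)) (i : Fin r) (hi : i ∈ F) :
    eVec r i ∈ simpl F := by
  refine ⟨fun j => ?_, fun j hj => ?_, ?_⟩
  · by_cases h : j = i
    · subst h; simp [eVec]
    · simp [eVec, h]
  · have h : j ≠ i := fun h => hj (h ▸ hi)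
    simp [eVec, h]
  · simp [eVec]

/-- For a strictly increasing vector `c`, the linear functional `x ↦ ∑ i, c i * x i` attains
its maximum over `P_𝓕` at the unique point `v` whose `i`-th coordinate is the number of
indices `j` such that `i` is the largest element of `F j`. -/
theorem linear_functional_max_at_unique_point {r k : ℕ} (F : Fin k → Finset (Fin r))
    (hF : ∀ j, (F j).Nonempty) (c : Fin r → ℝ) (hc : StrictMono c) :
    let v : Fin r → ℝ := fun i =>
      ((Finset.univ.filter fun j => (F j).max' (hF j) = i).card : ℝ)
    v ∈ mink F ∧ ∀ x ∈ mink F, x ≠ v → ∑ i, c i * x i < ∑ i, c i * v i := by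
  intro v
  have hv : v = ∑ j, eVec r ((F j).max' (hF j)) := by
    funext i
    simp [v, eVec, Finset.sum_apply, Pi.single_apply, eq_comm]
  have swap : ∀ g : Fin k → Fin r → ℝ,
      ∑ i, c i * (∑ j, g j) i = ∑ j, ∑ i, c i * g j i := by
    intro g
    simp only [Finset.sum_apply, Finset.mul_sum]
    exact Finset.sum_comm
  refine ⟨?_, ?_⟩
  · rw [hv, mink, Set.mem_finset_sum]
    exact ⟨_, fun {j} _ => eVec_mem_simpl _ _ ((F j).max'_mem (hF j)), rfl⟩
  · intro x hx hne
    rw [mink, Set.mem_finset_sum] at hx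
    obtain ⟨g, hg, rfl⟩ := hx
    have hg' : ∀ j, g j ∈ simpl (F j) := fun j => hg (Finset.mem_univ j)
    have hex : ∃ j, g j ≠ eVec r ((F j).max' (hF j)) := by
      by_contra! hcon
      exact hne (by rw [hv]; exact Finset.sum_congr rfl fun j _ => hcon j)
    obtain ⟨j, hj⟩ := hex
    rw [hv, swap, swap]
    have hval : ∀ j, ∑ i, c i * eVec r ((F j).max' (hF j)) i = c ((F j).max' (hF j)) := by
      intro j
      simp [eVec, Pi.single_apply]
    simp only [hval]
    exact Finset.sum_lt_sum (fun j _ => (simpl_le (F j) (hF j) c hc _ (hg' j)).1)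
      ⟨j, Finset.mem_univ j, (simpl_le (F j) (hF j) c hc _ (hg' j)).2 hj⟩
end

section
/- Let 𝓕 = (F_1,…,F_k) be a finite family of nonempty subsets of [r]. Then every vertex (extreme point) of P_𝓕 has integer coordinates; more precisely, every vertex is a sum e_{i_1} + ⋯ + e_{i_k} of k standard basis vectors with i_j ∈ F_j for each j. -/
open Pointwise

theorem simpl_eq_convexHull {r : ℕ} (F : Finset (Fin r)) :
    simpl F = convexHull ℝ (Set.image (eVec r) (F : Set (Fin r))) := by
  apply Set.Subset.antisymm
  · rintro x ⟨h0, hF, h1⟩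
    have hs : ∑ i ∈ F, x i = 1 := by
      rw [← h1]
      exact Finset.sum_subset (Finset.subset_univ F) (fun i _ hi => hF i hi)
    have hx : x = ∑ i ∈ F, x i • eVec r i := by
      funext l
      simp only [Finset.sum_apply, Pi.smul_apply, eVec, Pi.single_apply, smul_eq_mul, mul_ite,
        mul_one, mul_zero, Finset.sum_ite_eq]
      split_ifs with h
      · rfl
      · exact hF l h
    rw [hx]
    exact (convex_convexHull ℝ _).sum_mem (fun i _ => h0 i) hs
      (fun i hi => subset_convexHull ℝ _ ⟨i, hi, rfl⟩)
  · apply convexHull_min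
    · rintro _ ⟨i, hi, rfl⟩
      refine ⟨fun l => ?_, fun l hl => ?_, ?_⟩
      · simp only [eVec, Pi.single_apply]
        split_ifs <;> norm_num
      · have : l ≠ i := fun h => hl (h ▸ hi)
        simp [eVec, this]
      · simp [eVec]
    · rintro x ⟨hx0, hxF, hx1⟩ y ⟨hy0, hyF, hy1⟩ a b ha hb hab
      refine ⟨fun l => ?_, fun l hl => ?_, ?_⟩
      · have := hx0 l
        have := hy0 l
        simp only [Pi.add_apply, Pi.smul_apply, smul_eq_mul]
        positivity
      · simp [hxF l hl, hyF l hl]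
      · simp [Finset.sum_add_distrib, ← Finset.mul_sum, hx1, hy1, hab]

/-- Every vertex of `P_𝓕` has integer coordinates; more precisely, every vertex is a sum
`e_{i 0} + ⋯ + e_{i (k-1)}` of standard basis vectors with `i j ∈ F j` for each `j`. -/
theorem vertex_is_sum_of_basis_vectors {r k : ℕ} (F : Fin k → Finset (Fin r))
    (hF : ∀ j, (F j).Nonempty) (u : Fin r → ℝ)
    (hu : u ∈ Set.extremePoints ℝ (mink F)) :
    (∀ i, ∃ n : ℤ, u i = n) ∧
      ∃ f : Fin k → Fin r, (∀ j, f j ∈ F j) ∧ u = ∑ j, eVec r (f j) := by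
  have hm : mink F = convexHull ℝ (∑ j : Fin k, Set.image (eVec r) (F j : Set (Fin r))) := by
    rw [convexHull_sum]
    exact Finset.sum_congr rfl (fun j _ => simpl_eq_convexHull (F j))
  rw [hm] at hu
  obtain ⟨g, hg, hgu⟩ := Set.mem_fintype_sum _ _ |>.1 (extremePoints_convexHull_subset hu)
  choose f hf hfg using hg
  have huf : u = ∑ j, eVec r (f j) := by
    rw [← hgu]
    exact Finset.sum_congr rfl (fun j _ => (hfg j).symm)
  refine ⟨fun i => ⟨∑ j, if i = f j then 1 else 0, ?_⟩, f, hf, huf⟩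
  rw [huf]
  simp only [Finset.sum_apply, eVec, Pi.single_apply]
  push_cast
  rfl
end

section
/- Let F, F' be nonempty subsets of [r] and let P = Δ_F + Δ_{F'}. Let u be a vertex of P. (1) If u = e_i + e_j with i ∈ F∖F' and j ∈ F∩F', or u = 2e_j with j ∈ F∩F', or u = e_i + e_j with i ∈ F∩F' and j ∈ F'∖F, then the degree of u in P equals |F ∪ F'| − 1. (2) If u = e_i + e_j with i ∈ F∖F' and j ∈ F'∖F, then the degree of u in P equals |F| + |F'| − 2. -/
open Pointwise

/-- `y` is a nonnegative combination of the vectors `d k`. -/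
inductive InCone {r : ℕ} {ι : Type} (d : ι → Fin r → ℝ) : (Fin r → ℝ) → Prop
  | zero : InCone d 0
  | step (k : ι) (c : ℝ) (hc : 0 < c) (y : Fin r → ℝ) (hy : InCone d y) : InCone d (c • d k + y)

theorem InCone.add {r : ℕ} {ι : Type} {d : ι → Fin r → ℝ} {x y : Fin r → ℝ}
    (hx : InCone d x) (hy : InCone d y) : InCone d (x + y) := by
  induction hx with
  | zero => simpa using hy
  | step k c hc z _ ih => rw [add_assoc]; exact InCone.step k c hc _ ih

theorem InCone.smul {r : ℕ} {ι : Type} {d : ι → Fin r → ℝ} {x : Fin r → ℝ}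
    (hx : InCone d x) {t : ℝ} (ht : 0 ≤ t) : InCone d (t • x) := by
  rcases ht.eq_or_lt with rfl | ht
  · simpa using InCone.zero
  induction hx with
  | zero => simpa using InCone.zero
  | step k c hc z _ ih =>
    rw [smul_add, smul_smul]; exact InCone.step k _ (mul_pos ht hc) _ ih

theorem InCone.basic {r : ℕ} {ι : Type} {d : ι → Fin r → ℝ} (k : ι) : InCone d (d k) := by
  simpa using InCone.step k 1 one_pos 0 InCone.zero

theorem InCone.sum {r : ℕ} {ι : Type} {d : ι → Fin r → ℝ} {α : Type} (s : Finset α)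
    (f : α → Fin r → ℝ) (h : ∀ a ∈ s, InCone d (f a)) : InCone d (∑ a ∈ s, f a) := by
  classical
  induction s using Finset.induction_on with
  | empty => simpa using InCone.zero
  | insert a s ha ih =>
    rw [Finset.sum_insert ha]
    exact (h a (by simp)).add (ih fun b hb => h b (by simp [hb]))

theorem InCone.exists_mem {r : ℕ} {ι : Type} {d : ι → Fin r → ℝ} {P : Set (Fin r → ℝ)}
    (hP : Convex ℝ P) {u : Fin r → ℝ} (hu : u ∈ P) (hd : ∀ k, u + d k ∈ P) {y : Fin r → ℝ}
    (hy : InCone d y) : ∃ ε : ℝ, 0 < ε ∧ u + ε • y ∈ P := by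
  induction hy with
  | zero => exact ⟨1, one_pos, by simpa using hu⟩
  | step k c hc y _ ih =>
    obtain ⟨ε, hε, h⟩ := ih
    have hs : 0 < 1 + ε * c := by positivity
    refine ⟨ε / (1 + ε * c), by positivity, ?_⟩
    have := hP (hd k) h (a := ε * c / (1 + ε * c)) (b := 1 / (1 + ε * c)) (by positivity)
      (by positivity) (by field_simp; ring)
    convert this using 1
    ext x
    simp only [Pi.add_apply, Pi.smul_apply, smul_eq_mul]
    field_simp
    ring

theorem InCone.face {r : ℕ} {ι : Type} {d : ι → Fin r → ℝ} (k : ι)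
    (w : (Fin r → ℝ) →ₗ[ℝ] ℝ) (h0 : w (d k) = 0) (hl : ∀ l, l ≠ k → w (d l) < 0)
    {y : Fin r → ℝ} (hy : InCone d y) :
    w y ≤ 0 ∧ (w y = 0 → ∃ t : ℝ, 0 ≤ t ∧ y = t • d k) := by
  induction hy with
  | zero => exact ⟨by simp, fun _ => ⟨0, le_rfl, by simp⟩⟩
  | step l c hc y _ ih =>
    obtain ⟨h1, h2⟩ := ih
    by_cases hlk : l = k
    · subst hlk
      simp only [map_add, map_smul, h0, smul_zero, zero_add]
      refine ⟨h1, fun h => ?_⟩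
      obtain ⟨t, ht, rfl⟩ := h2 h
      exact ⟨c + t, by positivity, by rw [add_smul]⟩
    · have : c * w (d l) < 0 := mul_neg_of_pos_of_neg hc (hl l hlk)
      simp only [map_add, map_smul, smul_eq_mul]
      exact ⟨by linarith, fun h => by linarith⟩

/-- Vertex degree from an explicit description of the tangent cone. -/
theorem polyDeg_of_cone {r : ℕ} {ι : Type} {P : Set (Fin r → ℝ)}
    (hP : Convex ℝ P) {u : Fin r → ℝ} (hu : u ∈ Set.extremePoints ℝ P) (d : ι → Fin r → ℝ)
    (hd : ∀ k, u + d k ∈ P) (hcone : ∀ x ∈ P, InCone d (x - u))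
    (hw : ∀ k, ∃ w : (Fin r → ℝ) →ₗ[ℝ] ℝ, w (d k) = 0 ∧ ∀ l, l ≠ k → w (d l) < 0)
    (hdne : ∀ k, d k ≠ 0)
    (ht : ∀ k, ∀ t : ℝ, u + t • d k ∈ P → t ≤ 1) :
    polyDeg P u = Nat.card ι := by
  have huP := hu.1
  have key : ∀ k, ∀ t : ℝ, ∀ x ∈ P, ∀ y ∈ P, u + t • d k ∈ openSegment ℝ x y →
      (∃ s : ℝ, 0 ≤ s ∧ s ≤ 1 ∧ x = u + s • d k) := by
    intro k t x hx y hy hz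
    obtain ⟨w, h0, hl⟩ := hw k
    have fx := InCone.face k w h0 hl (hcone x hx)
    have fy := InCone.face k w h0 hl (hcone y hy)
    obtain ⟨a, b, ha, hb, hab, he⟩ := hz
    have hW := congrArg w he
    simp only [map_add, map_smul, h0, smul_eq_mul, mul_zero, add_zero] at hW
    have h1 := fx.1
    have h2 := fy.1
    rw [map_sub] at h1 h2
    have hx0 : w (x - u) = 0 := by
      rw [map_sub]
      have : a * (w x - w u) + b * (w y - w u) = 0 := by
        have : b = 1 - a := by linarith
        subst this; linarith
      nlinarith [mul_nonneg hb.le (neg_nonneg.2 h2), mul_nonneg ha.le (neg_nonneg.2 h1)]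
    obtain ⟨s, hs, hse⟩ := fx.2 hx0
    have hxe : x = u + s • d k := by rw [← hse]; abel
    exact ⟨s, hs, ht k s (hxe ▸ hx), hxe⟩
  have hvext : ∀ k, u + d k ∈ Set.extremePoints ℝ P := by
    intro k
    refine ⟨hd k, fun x hx y hy hz => ?_⟩
    have hz' : u + (1 : ℝ) • d k ∈ openSegment ℝ x y := by simpa using hz
    obtain ⟨s, hs0, hs1, rfl⟩ := key k 1 x hx y hy hz'
    obtain ⟨t, ht0, ht1, rfl⟩ := key k 1 y hy _ hx (by rwa [openSegment_symm])
    obtain ⟨a, b, ha, hb, hab, he⟩ := hz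
    have : (a * s + b * t - 1) • d k = 0 := by
      have hb' : b = 1 - a := by linarith
      subst hb'
      ext i
      have := congrFun he i
      simp only [Pi.add_apply, Pi.smul_apply, smul_eq_mul, Pi.zero_apply] at this ⊢
      linarith
    rcases smul_eq_zero.1 this with h | h
    · have : s = 1 := by nlinarith
      simp [this]
    · exact absurd h (hdne k)
  have hinj : Function.Injective (fun k => u + d k) := by
    intro k l hkl
    by_contra hne
    have h : d k = d l := add_left_cancel hkl
    obtain ⟨w, h0, hl⟩ := hw k
    have := hl l (Ne.symm hne)
    rw [← h] at this
    linarith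
  have hset : {v | IsEdgeOf P u v} = Set.range (fun k => u + d k) := by
    ext v
    constructor
    · rintro ⟨huv, -, hv, hE⟩
      have hc := hcone v hv.1
      generalize hy : v - u = y at hc
      cases hc with
      | zero => exact absurd (sub_eq_zero.1 hy).symm huv
      | step k c hc y hyc =>
        refine ⟨k, ?_⟩
        obtain ⟨ε, hε, hm⟩ := hyc.exists_mem hP huP hd
        have hs : 0 < 1 + ε * c := by positivity
        have hs' : 0 < 1 + ε + ε * c := by positivity
        -- a point of the open segment between the candidate and another point of P
        have hz : u + (ε / (1 + ε + ε * c)) • (v - u) ∈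
            openSegment ℝ (u + d k) (u + (ε / (1 + ε)) • y) := by
          refine ⟨ε * c / (1 + ε + ε * c), (1 + ε) / (1 + ε + ε * c), by positivity,
            by positivity, by field_simp; ring, ?_⟩
          rw [hy]
          ext x
          simp only [Pi.add_apply, Pi.smul_apply, smul_eq_mul]
          field_simp
          ring
        have hm' : u + (ε / (1 + ε)) • y ∈ P := by
          have := hP huP hm (a := ε / (1 + ε)) (b := 1 / (1 + ε)) (by positivity)
            (by positivity) (by field_simp; ring)
          convert this using 1
          ext x
          simp only [Pi.add_apply, Pi.smul_apply, smul_eq_mul]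
          field_simp
          ring
        have hzs : u + (ε / (1 + ε + ε * c)) • (v - u) ∈ segment ℝ u v := by
          refine ⟨1 - ε / (1 + ε + ε * c), ε / (1 + ε + ε * c), ?_, by positivity, by ring, ?_⟩
          · rw [sub_nonneg, div_le_one hs']; nlinarith [mul_pos hε hc]
          · ext x
            simp only [Pi.add_apply, Pi.smul_apply, smul_eq_mul, Pi.sub_apply]
            ring
        have hmem := hE.2 (hd k) hm' hzs hz
        rcases (mem_extremePoints_iff_forall_segment.1 (hvext k)).2 u huP v hv.1 hmem with h | h
        · exact absurd (by simpa using h.symm) (hdne k)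
        · exact h.symm
    · rintro ⟨k, rfl⟩
      refine ⟨?_, hu, hvext k, hP.segment_subset huP (hd k), ?_⟩
      · intro h
        exact hdne k (by simpa using h)
      · intro x hx y hy z hz hzo
        rw [segment_eq_image'] at hz
        obtain ⟨t, -, rfl⟩ := hz
        simp only [add_sub_cancel_left] at hzo
        obtain ⟨s, hs0, hs1, rfl⟩ := key k t x hx y hy hzo
        rw [segment_eq_image']
        exact ⟨s, ⟨hs0, hs1⟩, by simp⟩
  rw [polyDeg, hset, ← Set.image_univ, Set.ncard_image_of_injective _ hinj, Set.ncard_univ]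

theorem convex_simpl {r : ℕ} (F : Finset (Fin r)) : Convex ℝ (simpl F) := by
  rintro x ⟨hx1, hx2, hx3⟩ y ⟨hy1, hy2, hy3⟩ a b ha hb hab
  refine ⟨fun i => ?_, fun i hi => ?_, ?_⟩
  · have := hx1 i
    have := hy1 i
    simp only [Pi.add_apply, Pi.smul_apply, smul_eq_mul]
    positivity
  · simp [hx2 i hi, hy2 i hi]
  · simp [Finset.sum_add_distrib, ← Finset.mul_sum, hx3, hy3, hab]

theorem eVec_mem {r : ℕ} {F : Finset (Fin r)} {i : Fin r} (hi : i ∈ F) : eVec r i ∈ simpl F := by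
  refine ⟨fun k => ?_, fun k hk => ?_, ?_⟩
  · by_cases h : k = i <;> simp [eVec, Pi.single_apply, h]
  · have : k ≠ i := by rintro rfl; exact hk hi
    simp [eVec, Pi.single_apply, this]
  · simp [eVec]

theorem simpl_sub {r : ℕ} {F : Finset (Fin r)} {a : Fin r → ℝ} (ha : a ∈ simpl F) (i : Fin r) :
    a - eVec r i = ∑ k ∈ F, a k • (eVec r k - eVec r i) := by
  obtain ⟨h1, h2, h3⟩ := ha
  have hs : ∑ k ∈ F, a k = 1 := by
    rw [← h3]; exact Finset.sum_subset (Finset.subset_univ _) (fun k _ hk => h2 k hk)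
  simp only [smul_sub, Finset.sum_sub_distrib, ← Finset.sum_smul, hs, one_smul]
  congr 1
  ext x
  simp only [eVec, Finset.sum_apply, Pi.smul_apply, Pi.single_apply, smul_eq_mul, mul_ite, mul_one,
    mul_zero, Finset.sum_ite_eq]
  split_ifs with h
  · rfl
  · exact h2 x h

theorem simpl_cone {r : ℕ} {ι : Type} {d : ι → Fin r → ℝ} {F F' : Finset (Fin r)} {i j : Fin r}
    (h : ∀ k ∈ F, InCone d (eVec r k - eVec r i)) (h' : ∀ k ∈ F', InCone d (eVec r k - eVec r j))
    (x : Fin r → ℝ) (hx : x ∈ simpl F + simpl F') : InCone d (x - (eVec r i + eVec r j)) := by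
  obtain ⟨a, ha, b, hb, rfl⟩ := hx
  have : a + b - (eVec r i + eVec r j) = (a - eVec r i) + (b - eVec r j) := by abel
  change InCone d (a + b - _)
  rw [this, simpl_sub ha i, simpl_sub hb j]
  exact (InCone.sum _ _ fun k hk => (h k hk).smul (ha.1 k)).add
    (InCone.sum _ _ fun k hk => (h' k hk).smul (hb.1 k))

theorem exists_functional {r : ℕ} (w : Fin r → ℝ) :
    ∃ f : (Fin r → ℝ) →ₗ[ℝ] ℝ, ∀ k, f (eVec r k) = w k := by
  refine ⟨(Pi.basisFun ℝ (Fin r)).constr ℝ w, fun k => ?_⟩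
  rw [eVec, ← Pi.basisFun_apply, Module.Basis.constr_basis]

theorem sum_nonneg_coord {r : ℕ} {F F' : Finset (Fin r)} {x : Fin r → ℝ}
    (hx : x ∈ simpl F + simpl F') (i : Fin r) : 0 ≤ x i := by
  obtain ⟨a, ha, b, hb, rfl⟩ := hx
  exact add_nonneg (ha.1 i) (hb.1 i)

theorem simpl_le_one {r : ℕ} {F : Finset (Fin r)} {x : Fin r → ℝ}
    (hx : x ∈ simpl F) (i : Fin r) : x i ≤ 1 := by
  rw [← hx.2.2]
  exact Finset.single_le_sum (fun k _ => hx.1 k) (Finset.mem_univ i)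

theorem sum_le_one_coord {r : ℕ} {F F' : Finset (Fin r)} {x : Fin r → ℝ}
    (hx : x ∈ simpl F + simpl F') (i : Fin r) (hi : ¬ (i ∈ F ∧ i ∈ F')) : x i ≤ 1 := by
  obtain ⟨a, ha, b, hb, rfl⟩ := hx
  have h1 := simpl_le_one ha i
  have h2 := simpl_le_one hb i
  change a i + b i ≤ 1
  by_cases h : i ∈ F
  · rw [hb.2.1 i (fun h' => hi ⟨h, h'⟩)]; linarith
  · rw [ha.2.1 i h]; linarith

theorem eVec_sub_ne {r : ℕ} {i k : Fin r} (h : k ≠ i) : eVec r k - eVec r i ≠ 0 := by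
  intro h0
  have := congrFun h0 k
  simp [eVec, Pi.single_apply, h] at this

theorem deg_D {r : ℕ} (F F' : Finset (Fin r)) (i j : Fin r) (hi : i ∈ F) (hi' : i ∉ F')
    (hj : j ∈ F') (hj' : j ∉ F)
    (hu : eVec r i + eVec r j ∈ Set.extremePoints ℝ (simpl F + simpl F')) :
    polyDeg (simpl F + simpl F') (eVec r i + eVec r j) = F.card + F'.card - 2 := by
  have hij : i ≠ j := by rintro rfl; exact hj' hi
  let d : {k // k ∈ F.erase i} ⊕ {k // k ∈ F'.erase j} → Fin r → ℝ :=
    Sum.elim (fun k => eVec r k - eVec r i) (fun k => eVec r k - eVec r j)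
  rw [polyDeg_of_cone ((convex_simpl F).add (convex_simpl F')) hu d]
  · have := Finset.card_pos.2 ⟨i, hi⟩
    have := Finset.card_pos.2 ⟨j, hj⟩
    simp [Nat.card_eq_fintype_card, Finset.card_erase_of_mem, hi, hj, -Finset.mem_erase]
    omega
  · rintro (⟨k, hk⟩ | ⟨k, hk⟩)
    · have := Set.add_mem_add (eVec_mem (Finset.mem_of_mem_erase hk)) (eVec_mem hj)
      convert this using 1
      simp only [d, Sum.elim_inl]; abel
    · have := Set.add_mem_add (eVec_mem hi) (eVec_mem (Finset.mem_of_mem_erase hk))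
      convert this using 1
      simp only [d, Sum.elim_inr]; abel
  · apply simpl_cone
    · intro k hk
      by_cases h : k = i
      · subst h; simpa using InCone.zero
      · exact InCone.basic (d := d) (Sum.inl ⟨k, by simp [h, hk]⟩)
    · intro k hk
      by_cases h : k = j
      · subst h; simpa using InCone.zero
      · exact InCone.basic (d := d) (Sum.inr ⟨k, by simp [h, hk]⟩)
  · rintro (⟨m, hm⟩ | ⟨m, hm⟩)
    · obtain ⟨f, hf⟩ := exists_functional
        (fun x => if x = i ∨ x = m then 0 else if x = j then 1 else (-1 : ℝ))
      rw [Finset.mem_erase] at hm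
      have hmj : j ≠ m := by rintro rfl; exact hj' hm.2
      refine ⟨f, by simp [d, hf], ?_⟩
      rintro (⟨k, hk⟩ | ⟨k, hk⟩) hne <;> rw [Finset.mem_erase] at hk
      · have h1 : k ≠ m := by rintro rfl; exact hne rfl
        have h2 : k ≠ j := by rintro rfl; exact hj' hk.2
        simp [d, hf, h1, h2, hk.1]
      · simp only [d, Sum.elim_inr, map_sub, hf, hij.symm, hmj, hk.1]
        split_ifs <;> norm_num <;> simp_all
    · obtain ⟨f, hf⟩ := exists_functional
        (fun x => if x = j ∨ x = m then 0 else if x = i then 1 else (-1 : ℝ))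
      rw [Finset.mem_erase] at hm
      have hmi : i ≠ m := by rintro rfl; exact hi' hm.2
      refine ⟨f, by simp [d, hf], ?_⟩
      rintro (⟨k, hk⟩ | ⟨k, hk⟩) hne <;> rw [Finset.mem_erase] at hk
      · simp only [d, Sum.elim_inl, map_sub, hf, hij, hmi, hk.1]
        split_ifs <;> norm_num <;> simp_all
      · have h1 : k ≠ m := by rintro rfl; exact hne rfl
        have h2 : k ≠ i := by rintro rfl; exact hi' hk.2
        simp [d, hf, h1, h2, hk.1]
  · rintro (⟨k, hk⟩ | ⟨k, hk⟩) <;> rw [Finset.mem_erase] at hk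
    · exact eVec_sub_ne hk.1
    · exact eVec_sub_ne hk.1
  · rintro (⟨k, hk⟩ | ⟨k, hk⟩) t hx <;> rw [Finset.mem_erase] at hk
    · have := sum_nonneg_coord hx i
      simp [d, eVec, Pi.single_apply, hij, hk.1.symm] at this
      linarith
    · have := sum_nonneg_coord hx j
      simp [d, eVec, Pi.single_apply, hij.symm, hk.1.symm] at this
      linarith

theorem deg_A {r : ℕ} (F F' : Finset (Fin r)) (i j : Fin r) (hi : i ∈ F) (hi' : i ∉ F')
    (hj : j ∈ F') (hj' : j ∈ F)
    (hu : eVec r i + eVec r j ∈ Set.extremePoints ℝ (simpl F + simpl F')) :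
    polyDeg (simpl F + simpl F') (eVec r i + eVec r j) = (F ∪ F').card - 1 := by
  have hij : i ≠ j := by rintro rfl; exact hi' hj
  let p : Fin r → Fin r := fun k => if k ∈ F' ∧ k ≠ j then j else i
  let d : {k // k ∈ (F ∪ F').erase i} → Fin r → ℝ := fun k => eVec r k - eVec r (p k)
  have hdi : ∀ k (hk : k ∈ (F ∪ F').erase i), ¬ (k ∈ F' ∧ k ≠ j) →
      d ⟨k, hk⟩ = eVec r k - eVec r i := fun k hk h => by simp only [d, p, if_neg h]
  have hdj : ∀ k (hk : k ∈ (F ∪ F').erase i), (k ∈ F' ∧ k ≠ j) →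
      d ⟨k, hk⟩ = eVec r k - eVec r j := fun k hk h => by simp only [d, p, if_pos h]
  have hc' : ∀ k ∈ F', InCone d (eVec r k - eVec r j) := by
    intro k hk
    by_cases h : k = j
    · subst h; simpa using InCone.zero
    · have hki : k ≠ i := by rintro rfl; exact hi' hk
      have := InCone.basic (d := d) ⟨k, by simp [hk, hki]⟩
      rwa [hdj k _ ⟨hk, h⟩] at this
  have hcj : InCone d (eVec r j - eVec r i) := by
    have := InCone.basic (d := d) ⟨j, by simp [hj, hij.symm]⟩
    rwa [hdi j _ (by simp)] at this
  rw [polyDeg_of_cone ((convex_simpl F).add (convex_simpl F')) hu d]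
  · rw [Nat.card_eq_fintype_card, Fintype.card_coe, Finset.card_erase_of_mem (by simp [hi])]
  · rintro ⟨k, hk⟩
    by_cases h : k ∈ F' ∧ k ≠ j
    · rw [hdj k hk h]
      convert Set.add_mem_add (eVec_mem hi) (eVec_mem h.1) using 1
      abel
    · rw [hdi k hk h]
      have hkF : k ∈ F := by
        by_contra hkF
        have : k ∈ F' := by simpa [hkF] using (Finset.mem_of_mem_erase hk)
        exact h ⟨this, by rintro rfl; exact hkF hj'⟩
      convert Set.add_mem_add (eVec_mem hkF) (eVec_mem hj) using 1
      abel
  · apply simpl_cone _ hc'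
    intro k hk
    by_cases h : k = i
    · subst h; simpa using InCone.zero
    by_cases h' : k ∈ F' ∧ k ≠ j
    · have := (hc' k h'.1).add hcj
      simpa using this
    · have := InCone.basic (d := d) ⟨k, by simp [h, hk]⟩
      rwa [hdi k _ h'] at this
  · rintro ⟨m, hm⟩
    rw [Finset.mem_erase] at hm
    obtain ⟨f, hf⟩ := exists_functional
      (fun x => if x = i then (0 : ℝ) else if x = j then (if m = j then 0 else -1) else
        if x = m then (if m ∈ F' then -1 else 0) else -2)
    refine ⟨f, ?_, ?_⟩
    · by_cases h : m ∈ F' ∧ m ≠ j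
      · rw [hdj m _ h]
        simp [hf, hij.symm, h.1, h.2, hm.1]
      · rw [hdi m _ h]
        by_cases hmj : m = j
        · simp [hf, hmj]
        · have : m ∉ F' := fun h' => h ⟨h', hmj⟩
          simp [hf, hmj, this]
    · rintro ⟨k, hk⟩ hne
      have h1 : k ≠ m := by rintro rfl; exact hne rfl
      have hki : k ≠ i := Finset.ne_of_mem_erase hk
      by_cases h : k ∈ F' ∧ k ≠ j
      · rw [hdj k _ h]
        simp only [map_sub, hf, hki, h.2, h1, hij.symm, if_false, if_true]
        split_ifs <;> norm_num
      · rw [hdi k _ h]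
        simp only [map_sub, hf, hki, h1, if_false, if_true]
        split_ifs with h2 h3
        · exact absurd (h2.trans h3.symm) h1
        · norm_num
        · norm_num
  · rintro ⟨k, hk⟩
    by_cases h : k ∈ F' ∧ k ≠ j
    · rw [hdj k _ h]; exact eVec_sub_ne h.2
    · rw [hdi k _ h]; exact eVec_sub_ne (Finset.ne_of_mem_erase hk)
  · rintro ⟨k, hk⟩ t hx
    have hki : k ≠ i := Finset.ne_of_mem_erase hk
    by_cases h : k ∈ F' ∧ k ≠ j
    · rw [hdj k _ h] at hx
      have := sum_nonneg_coord hx j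
      simp [eVec, Pi.single_apply, hij.symm, h.2.symm] at this
      linarith
    · rw [hdi k _ h] at hx
      have := sum_nonneg_coord hx i
      simp [eVec, Pi.single_apply, hij, hki.symm] at this
      linarith

theorem deg_B {r : ℕ} (F F' : Finset (Fin r)) (j : Fin r)
    (hj : j ∈ F) (hj' : j ∈ F')
    (hu : eVec r j + eVec r j ∈ Set.extremePoints ℝ (simpl F + simpl F')) :
    polyDeg (simpl F + simpl F') (eVec r j + eVec r j) = (F ∪ F').card - 1 := by
  let s : Fin r → ℝ := fun k => if k ∈ F ∧ k ∈ F' then 2 else 1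
  have hs : ∀ k, 0 < s k := by intro k; simp only [s]; split_ifs <;> norm_num
  let d : {k // k ∈ (F ∪ F').erase j} → Fin r → ℝ := fun k => s k • (eVec r k - eVec r j)
  have hc : ∀ k ∈ F ∪ F', InCone d (eVec r k - eVec r j) := by
    intro k hk
    by_cases h : k = j
    · subst h; simpa using InCone.zero
    · have := (InCone.basic (d := d) ⟨k, Finset.mem_erase.2 ⟨h, hk⟩⟩).smul (inv_pos.2 (hs k)).le
      simpa only [d, smul_smul, inv_mul_cancel₀ (hs k).ne', one_smul] using this
  rw [polyDeg_of_cone ((convex_simpl F).add (convex_simpl F')) hu d]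
  · rw [Nat.card_eq_fintype_card, Fintype.card_coe, Finset.card_erase_of_mem (by simp [hj])]
  · rintro ⟨k, hk⟩
    have hk' := Finset.mem_union.1 (Finset.mem_of_mem_erase hk)
    by_cases h : k ∈ F ∧ k ∈ F'
    · convert Set.add_mem_add (eVec_mem h.1) (eVec_mem h.2) using 1
      simp only [d, s, if_pos h, two_smul]; abel
    · rcases hk' with h' | h'
      · convert Set.add_mem_add (eVec_mem h') (eVec_mem hj') using 1
        simp only [d, s, if_neg h, one_smul]; abel
      · convert Set.add_mem_add (eVec_mem hj) (eVec_mem h') using 1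
        simp only [d, s, if_neg h, one_smul]; abel
  · exact simpl_cone (fun k hk => hc k (by simp [hk])) (fun k hk => hc k (by simp [hk]))
  · rintro ⟨m, hm⟩
    obtain ⟨f, hf⟩ := exists_functional (fun x => if x = j ∨ x = m then (0 : ℝ) else -1)
    refine ⟨f, by simp [d, hf], ?_⟩
    rintro ⟨k, hk⟩ hne
    have h1 : k ≠ m := by rintro rfl; exact hne rfl
    have hkj : k ≠ j := Finset.ne_of_mem_erase hk
    simp [d, hf, h1, hkj, hs k]
  · rintro ⟨k, hk⟩
    exact smul_ne_zero (hs k).ne' (eVec_sub_ne (Finset.ne_of_mem_erase hk))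
  · rintro ⟨k, hk⟩ t hx
    have hkj : k ≠ j := Finset.ne_of_mem_erase hk
    by_cases h : k ∈ F ∧ k ∈ F'
    · have := sum_nonneg_coord hx j
      simp [d, s, h, eVec, Pi.single_apply, hkj.symm] at this
      linarith
    · have := sum_le_one_coord hx k h
      simp only [d, s, if_neg h] at this
      simpa [eVec, Pi.single_apply, hkj] using this

/-- Degrees of vertices of `P = Δ_F + Δ_{F'}`: a vertex of type `A`, `B` or `C` has degree
`|F ∪ F'| - 1`, while a vertex of type `D` has degree `|F| + |F'| - 2`. -/
theorem degree_of_vertex_of_sum_of_two {r : ℕ} (F F' : Finset (Fin r))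
    (hF : F.Nonempty) (hF' : F'.Nonempty) (u : Fin r → ℝ)
    (hu : u ∈ Set.extremePoints ℝ (simpl F + simpl F')) :
    (((∃ i ∈ F \ F', ∃ j ∈ F ∩ F', u = eVec r i + eVec r j) ∨
      (∃ j ∈ F ∩ F', u = (2 : ℝ) • eVec r j) ∨
      (∃ i ∈ F ∩ F', ∃ j ∈ F' \ F, u = eVec r i + eVec r j)) →
        polyDeg (simpl F + simpl F') u = (F ∪ F').card - 1) ∧
    ((∃ i ∈ F \ F', ∃ j ∈ F' \ F, u = eVec r i + eVec r j) →
        polyDeg (simpl F + simpl F') u = F.card + F'.card - 2) := by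
  constructor
  · rintro (⟨i, hi, j, hj, rfl⟩ | ⟨j, hj, rfl⟩ | ⟨i, hi, j, hj, rfl⟩)
    · rw [Finset.mem_sdiff] at hi
      rw [Finset.mem_inter] at hj
      exact deg_A F F' i j hi.1 hi.2 hj.2 hj.1 hu
    · rw [Finset.mem_inter] at hj
      rw [two_smul] at hu ⊢
      exact deg_B F F' j hj.1 hj.2 hu
    · rw [Finset.mem_sdiff] at hj
      rw [Finset.mem_inter] at hi
      rw [add_comm (eVec r i), add_comm (simpl F)] at hu ⊢
      rw [Finset.union_comm]
      exact deg_A F' F j i hj.1 hj.2 hi.1 hi.2 hu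
  · rintro ⟨i, hi, j, hj, rfl⟩
    rw [Finset.mem_sdiff] at hi hj
    exact deg_D F F' i j hi.1 hi.2 hj.1 hj.2 hu
end

section
/- Let 𝓕 = (F_1,…,F_k) be a finite family of nonempty subsets of [r], let f and g be rep-functions for 𝓕, let i_1 ≠ i_2 be elements of [r] and let t be a positive integer such that u(g) = u(f) + t·e_{i_1} − t·e_{i_2}. Then for every l with 1 ≤ l ≤ t − 1 there exists a rep-function f_l for 𝓕 with u(f_l) = u(f) + l·e_{i_1} − l·e_{i_2}. -/
open Pointwise

lemma urep_update_aux {r k : ℕ} (f : Fin k → Fin r) (j : Fin k) (y : Fin r) :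
    urep (Function.update f j y) = urep f - eVec r (f j) + eVec r y := by
  unfold urep
  rw [← Finset.add_sum_erase _ _ (Finset.mem_univ j),
    ← Finset.add_sum_erase _ (fun j => eVec r (f j)) (Finset.mem_univ j)]
  have : ∑ x ∈ Finset.univ.erase j, eVec r (Function.update f j y x)
      = ∑ x ∈ Finset.univ.erase j, eVec r (f x) := by
    refine Finset.sum_congr rfl fun x hx => ?_
    rw [Function.update_of_ne (Finset.ne_of_mem_erase hx)]
  rw [this]
  simp only [Function.update_self]
  abel

lemma eVec_apply_aux {r : ℕ} (i z : Fin r) : eVec r i z = if z = i then 1 else 0 := by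
  simp [eVec, Pi.single_apply]

/-- Follow a path of switches `f j ↦ g j` from `x` to `i₁`. -/
lemma exists_step_aux {r k : ℕ} (F : Fin k → Finset (Fin r)) (g : Fin k → Fin r)
    (hg : ∀ j, g j ∈ F j) (i₁ : Fin r) (n : ℕ) :
    ∀ (f : Fin k → Fin r) (x : Fin r), (∀ j, f j ∈ F j) →
      (Finset.univ.filter fun j => f j ≠ g j).card = n →
      (x = i₁ ∨ (urep g x - urep f x ≤ -1 ∧ ∀ z, z ≠ i₁ → urep g z - urep f z ≤ 0)) →
      ∃ f' : Fin k → Fin r, (∀ j, f' j ∈ F j) ∧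
        urep f' = urep f + eVec r i₁ - eVec r x := by
  induction n using Nat.strong_induction_on with
  | _ n ih =>
    intro f x hf hn hx
    by_cases hxi : x = i₁
    · exact ⟨f, hf, by rw [hxi]; abel⟩
    obtain ⟨hd, hz⟩ := hx.resolve_left hxi
    have hlt : ∑ j, eVec r (g j) x < ∑ j, eVec r (f j) x := by
      have h1 : urep g x < urep f x := by linarith
      simpa [urep, Finset.sum_apply] using h1
    obtain ⟨j, -, hj⟩ := Finset.exists_lt_of_sum_lt hlt
    simp only [eVec_apply_aux] at hj
    have hfj : x = f j := by
      by_contra h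
      rw [if_neg h] at hj
      split_ifs at hj <;> linarith
    have hgj : x ≠ g j := by
      intro h
      rw [if_pos h] at hj
      split_ifs at hj <;> linarith
    have hu := urep_update_aux f j (g j)
    rw [← hfj] at hu
    have hcard : (Finset.univ.filter fun a => Function.update f j (g j) a ≠ g a).card < n := by
      rw [← hn]
      apply Finset.card_lt_card
      rw [Finset.ssubset_iff_of_subset]
      · refine ⟨j, ?_, ?_⟩
        · simp [← hfj, hgj]
        · simp
      · intro a
        by_cases ha : a = j
        · subst ha; simp
        · simp [Function.update_of_ne ha]
    obtain ⟨f', hf', hu'⟩ := ih _ hcard (Function.update f j (g j)) (g j) (by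
        intro a
        by_cases ha : a = j
        · subst ha; simpa using hg a
        · simpa [Function.update_of_ne ha] using hf a) rfl (by
        by_cases hy : g j = i₁
        · exact Or.inl hy
        right
        rw [hu]
        simp only [Pi.add_apply, Pi.sub_apply, eVec_apply_aux]
        refine ⟨?_, fun z hzi => ?_⟩
        · have := hz _ hy
          rw [if_neg hgj.symm, if_pos trivial]
          linarith
        · have := hz z hzi
          by_cases hzx : z = x
          · subst hzx
            rw [if_pos rfl, if_neg hgj]
            linarith
          · rw [if_neg hzx]
            split_ifs <;> linarith)
    exact ⟨f', hf', by rw [hu', hu]; abel⟩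

/-- If `f, g` are rep-functions with `u(g) = u(f) + t·e_{i₁} − t·e_{i₂}` for distinct
`i₁ ≠ i₂` and `t ≥ 1`, then for each `1 ≤ l ≤ t − 1` there is a rep-function `f_l` with
`u(f_l) = u(f) + l·e_{i₁} − l·e_{i₂}`. -/
theorem exists_intermediate_rep_functions {r k : ℕ} (F : Fin k → Finset (Fin r))
    (f g : Fin k → Fin r) (hf : ∀ j, f j ∈ F j) (hg : ∀ j, g j ∈ F j)
    (i₁ i₂ : Fin r) (hne : i₁ ≠ i₂) (t : ℕ) (ht : 0 < t)
    (hug : urep g = urep f + (t : ℝ) • eVec r i₁ - (t : ℝ) • eVec r i₂) :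
    ∀ l : ℕ, 1 ≤ l → l ≤ t - 1 →
      ∃ fl : Fin k → Fin r, (∀ j, fl j ∈ F j) ∧
        urep fl = urep f + (l : ℝ) • eVec r i₁ - (l : ℝ) • eVec r i₂ := by
  have key : ∀ l : ℕ, l ≤ t → ∃ fl : Fin k → Fin r, (∀ j, fl j ∈ F j) ∧
        urep fl = urep f + (l : ℝ) • eVec r i₁ - (l : ℝ) • eVec r i₂ := by
    intro l
    induction l with
    | zero => exact fun _ => ⟨f, hf, by simp⟩
    | succ l ih =>
      intro hl
      obtain ⟨fl, hfl, hu⟩ := ih (by omega)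
      have hlt : (l : ℝ) + 1 ≤ t := by exact_mod_cast hl
      obtain ⟨f', hf', hu'⟩ := exists_step_aux F g hg i₁ _ fl i₂ hfl rfl (by
        right
        rw [hug, hu]
        simp only [Pi.add_apply, Pi.sub_apply, Pi.smul_apply, smul_eq_mul, eVec_apply_aux]
        refine ⟨?_, fun z hz => ?_⟩
        · rw [if_neg hne.symm, if_pos trivial]
          linarith
        · rw [if_neg hz]
          split_ifs <;> linarith)
      refine ⟨f', hf', ?_⟩
      rw [hu', hu]
      push_cast
      module
  intro l _ hl
  exact key l (by omega)
end

section
/- Let 𝓕 = (F_1,…,F_k) be a finite family of nonempty subsets of [r]. If v ∈ P_𝓕 has all coordinates integers, then there exists a rep-function f for 𝓕 with v = u(f). -/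
open Pointwise

/-- Every integer point of `P_𝓕` is `u(f)` for some rep-function `f`. -/
theorem integer_point_is_urep {r k : ℕ} (F : Fin k → Finset (Fin r))
    (hF : ∀ j, (F j).Nonempty) (v : Fin r → ℝ) (hv : v ∈ mink F)
    (hint : ∀ i, ∃ n : ℤ, v i = n) :
    ∃ f : Fin k → Fin r, (∀ j, f j ∈ F j) ∧ v = urep f := by
  classical
  obtain ⟨x, hx', hxv⟩ := (Set.mem_fintype_sum _ _).mp hv
  have hvi : ∀ i, v i = ∑ j, x j i := by
    intro i
    rw [← hxv, Finset.sum_apply]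
  have hnat : ∀ i, ∃ n : ℕ, v i = n := by
    intro i
    obtain ⟨m, hm⟩ := hint i
    have h0 : 0 ≤ v i := by
      rw [hvi]
      exact Finset.sum_nonneg fun j _ => (hx' j).1 i
    have hm0 : 0 ≤ m := by
      rw [hm] at h0
      exact_mod_cast h0
    lift m to ℕ using hm0
    exact ⟨m, by simpa using hm⟩
  choose n hn using hnat
  let t : Fin k → Finset (Σ i : Fin r, Fin (n i)) := fun j => (F j).sigma fun _ => Finset.univ
  have hall : ∀ A : Finset (Fin k), A.card ≤ (A.biUnion t).card := by
    intro A
    have hb : A.biUnion t = (A.biUnion F).sigma fun _ => Finset.univ := by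
      ext p
      simp [t]
    rw [hb, Finset.card_sigma]
    simp only [Finset.card_univ, Fintype.card_fin]
    have : (A.card : ℝ) ≤ ∑ i ∈ A.biUnion F, (n i : ℝ) := by
      calc (A.card : ℝ) = ∑ j ∈ A, ∑ i ∈ A.biUnion F, x j i := by
            rw [Finset.card_eq_sum_ones]
            push_cast
            refine Finset.sum_congr rfl fun j hj => ?_
            rw [← (hx' j).2.2]
            symm
            refine Finset.sum_subset (Finset.subset_univ _) fun i _ hi => ?_
            refine (hx' j).2.1 i fun h => hi ?_
            exact Finset.mem_biUnion.mpr ⟨j, hj, h⟩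
        _ = ∑ i ∈ A.biUnion F, ∑ j ∈ A, x j i := Finset.sum_comm
        _ ≤ ∑ i ∈ A.biUnion F, (n i : ℝ) := by
            refine Finset.sum_le_sum fun i _ => ?_
            rw [← hn, hvi]
            exact Finset.sum_le_sum_of_subset_of_nonneg (Finset.subset_univ _)
              fun j _ _ => (hx' j).1 i
    exact_mod_cast this
  obtain ⟨f, hf, hft⟩ := (Finset.all_card_le_biUnion_card_iff_exists_injective t).mp hall
  have hcard : Fintype.card (Fin k) = Fintype.card (Σ i : Fin r, Fin (n i)) := by
    have : (k : ℝ) = ∑ i, (n i : ℝ) := by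
      simp_rw [← hn, hvi]
      rw [Finset.sum_comm]
      simp [fun j => (hx' j).2.2]
    simp only [Fintype.card_fin, Fintype.card_sigma]
    exact_mod_cast this
  have hbij : Function.Bijective f := (Fintype.bijective_iff_injective_and_card f).mpr ⟨hf, hcard⟩
  refine ⟨fun j => (f j).1, fun j => (Finset.mem_sigma.mp (hft j)).1, ?_⟩
  funext i
  rw [hn, urep, Finset.sum_apply]
  rw [hbij.sum_comp (fun p : (Σ i : Fin r, Fin (n i)) => eVec r p.1 i)]
  rw [Fintype.sum_sigma]
  simp [eVec, Pi.single_apply]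
end

section
/- Let 𝓕 = (F_1,…,F_k) be a finite family of nonempty subsets of [r], let v be a point of P_𝓕 with integer coordinates that is not a vertex of P_𝓕, and let Q be the smallest face of P_𝓕 containing v (the intersection of all extreme subsets of P_𝓕 containing v). If some edge of Q is parallel to e_{i_1} − e_{i_2} for distinct i_1, i_2 ∈ [r], then both v + e_{i_1} − e_{i_2} and v − e_{i_1} + e_{i_2} lie in P_𝓕. -/
open Pointwise

lemma mink_lower {r k : ℕ} (F : Fin k → Finset (Fin r)) (x : Fin r → ℝ) (hx : x ∈ mink F)
    (S : Finset (Fin r)) :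
    ((Finset.univ.filter (fun j => F j ⊆ S)).card : ℝ) ≤ ∑ i ∈ S, x i := by
  obtain ⟨g, hg, rfl⟩ := (Set.mem_fintype_sum _ _).1 hx
  have h1 : ∑ i ∈ S, (∑ j, g j) i = ∑ j, ∑ i ∈ S, g j i := by
    rw [Finset.sum_comm]; simp
  rw [h1, Finset.card_filter]
  push_cast
  apply Finset.sum_le_sum
  intro j _
  obtain ⟨h0, hz, hs⟩ := hg j
  split_ifs with h
  · rw [← hs]
    apply le_of_eq
    symm
    apply Finset.sum_subset (Finset.subset_univ S)
    intro i _ hi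
    exact hz i (fun hh => hi (h hh))
  · exact Finset.sum_nonneg (fun i _ => h0 i)

lemma mink_sum {r k : ℕ} (F : Fin k → Finset (Fin r)) (x : Fin r → ℝ) (hx : x ∈ mink F) :
    ∑ i, x i = k := by
  obtain ⟨g, hg, rfl⟩ := (Set.mem_fintype_sum _ _).1 hx
  have h1 : ∑ i, (∑ j, g j) i = ∑ j, ∑ i, g j i := by
    rw [Finset.sum_comm]; simp
  rw [h1, Finset.sum_congr rfl (fun j _ => (hg j).2.2)]
  simp

/-- Integer points satisfying the lower bounds lie in the Minkowski sum (Hall's theorem). -/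
lemma mem_mink_of_nat {r k : ℕ} (F : Fin k → Finset (Fin r)) (x : Fin r → ℕ)
    (hs : ∑ i, x i = k)
    (hl : ∀ S : Finset (Fin r), (Finset.univ.filter (fun j => F j ⊆ S)).card ≤ ∑ i ∈ S, x i) :
    (fun i => (x i : ℝ)) ∈ mink F := by
  classical
  let t : Fin k → Finset (Σ i : Fin r, Fin (x i)) := fun j => (F j).sigma (fun _ => Finset.univ)
  have hall : ∀ J : Finset (Fin k), J.card ≤ (J.biUnion t).card := by
    intro J
    have h1 : J.biUnion t = (J.biUnion F).sigma (fun _ => Finset.univ) := by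
      ext ⟨i, a⟩
      simp [t]
    rw [h1, Finset.card_sigma]
    simp only [Finset.card_univ, Fintype.card_fin]
    refine le_trans (Finset.card_le_card ?_) (hl (J.biUnion F))
    intro j hj
    simp only [Finset.mem_filter, Finset.mem_univ, true_and]
    exact Finset.subset_biUnion_of_mem F hj
  obtain ⟨f, hinj, hf⟩ := (Finset.all_card_le_biUnion_card_iff_exists_injective t).1 hall
  have hbij : Function.Bijective f := by
    rw [Fintype.bijective_iff_injective_and_card]
    exact ⟨hinj, by simp [hs]⟩
  refine (Set.mem_fintype_sum _ _).2 ⟨fun j => eVec r (f j).1, fun j => ⟨?_, ?_, ?_⟩, ?_⟩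
  · intro i
    simp only [eVec, Pi.single_apply]
    split_ifs <;> norm_num
  · intro i hi
    have := hf j
    simp only [t, Finset.mem_sigma, Finset.mem_univ, and_true] at this
    simp only [eVec, Pi.single_apply]
    rw [if_neg]
    rintro rfl
    exact hi this
  · simp [eVec]
  · rw [hbij.sum_comp (fun p => eVec r p.1), Fintype.sum_sigma]
    ext i
    simp [eVec, Pi.single_apply]

lemma mem_mink_of_int {r k : ℕ} (F : Fin k → Finset (Fin r)) (x : Fin r → ℝ)
    (hint : ∀ i, ∃ n : ℤ, x i = n) (hs : ∑ i, x i = k)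
    (hl : ∀ S : Finset (Fin r),
      ((Finset.univ.filter (fun j => F j ⊆ S)).card : ℝ) ≤ ∑ i ∈ S, x i) :
    x ∈ mink F := by
  have h : ∀ i, ∃ n : ℕ, x i = n := by
    intro i
    obtain ⟨n, hn⟩ := hint i
    have h0 : 0 ≤ x i := by
      have := hl {i}
      rw [Finset.sum_singleton] at this
      exact le_trans (Nat.cast_nonneg _) this
    rw [hn] at h0
    lift n to ℕ using by exact_mod_cast h0
    exact ⟨n, by simpa using hn⟩
  choose n hn using h
  obtain rfl : x = fun i => (n i : ℝ) := funext hn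
  simp only at hs hl
  exact mem_mink_of_nat F n (by exact_mod_cast hs) (fun S => by exact_mod_cast hl S)

lemma face_extreme {r k : ℕ} (F : Fin k → Finset (Fin r)) (S : Finset (Fin r)) :
    IsExtreme ℝ (mink F) {x | x ∈ mink F ∧
      ∑ i ∈ S, x i = ((Finset.univ.filter (fun j => F j ⊆ S)).card : ℝ)} := by
  refine ⟨fun x hx => hx.1, ?_⟩
  rintro x hx y hy z ⟨hz, hzS⟩ ⟨a, b, ha, hb, hab, rfl⟩
  refine ⟨hx, ?_⟩
  have h1 := mink_lower F x hx S
  have h2 := mink_lower F y hy S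
  simp only [Pi.add_apply, Pi.smul_apply, smul_eq_mul, Finset.sum_add_distrib,
    ← Finset.mul_sum] at hzS
  generalize ((Finset.univ.filter (fun j => F j ⊆ S)).card : ℝ) = c at *
  apply le_antisymm _ h1
  by_contra hc
  push Not at hc
  have e : c = a * c + b * c := by rw [← add_mul, hab, one_mul]
  nlinarith [mul_lt_mul_of_pos_left hc ha, mul_le_mul_of_nonneg_left h2 hb.le]

lemma strict_of_sep {r k : ℕ} (F : Fin k → Finset (Fin r)) (v : Fin r → ℝ) (hv : v ∈ mink F)
    (i₁ i₂ : Fin r)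
    (hedge : ∃ u w : Fin r → ℝ,
      IsEdgeOf (⋂₀ {A : Set (Fin r → ℝ) | IsExtreme ℝ (mink F) A ∧ v ∈ A}) u w ∧
      ∃ α : ℝ, α ≠ 0 ∧ w - u = α • (eVec r i₁ - eVec r i₂))
    (S : Finset (Fin r)) (hS : ¬ (i₁ ∈ S ↔ i₂ ∈ S)) :
    ((Finset.univ.filter (fun j => F j ⊆ S)).card : ℝ) < ∑ i ∈ S, v i := by
  apply lt_of_le_of_ne (mink_lower F v hv S)
  intro heq
  obtain ⟨u, w, ⟨-, hu, hw, -⟩, α, hα, huw⟩ := hedge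
  have hu' := (Set.mem_sInter.1 hu.1 _ ⟨face_extreme F S, hv, heq.symm⟩).2
  have hw' := (Set.mem_sInter.1 hw.1 _ ⟨face_extreme F S, hv, heq.symm⟩).2
  have h : ∑ i ∈ S, (w - u) i = 0 := by
    simp only [Pi.sub_apply, Finset.sum_sub_distrib]
    rw [hu', hw', sub_self]
  rw [huw] at h
  simp only [eVec, Pi.smul_apply, Pi.sub_apply, Pi.single_apply, smul_eq_mul, ← Finset.mul_sum,
    Finset.sum_sub_distrib, Finset.sum_ite_eq'] at h
  by_cases h1 : i₁ ∈ S <;> by_cases h2 : i₂ ∈ S <;> simp_all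

lemma move_mem {r k : ℕ} (F : Fin k → Finset (Fin r)) (v : Fin r → ℝ) (hv : v ∈ mink F)
    (hint : ∀ i, ∃ n : ℤ, v i = n) (i₁ i₂ : Fin r)
    (hst : ∀ S : Finset (Fin r), ¬ (i₁ ∈ S ↔ i₂ ∈ S) →
      ((Finset.univ.filter (fun j => F j ⊆ S)).card : ℝ) < ∑ i ∈ S, v i) :
    v + eVec r i₁ - eVec r i₂ ∈ mink F := by
  have key : ∀ S : Finset (Fin r), ∑ i ∈ S, (v + eVec r i₁ - eVec r i₂) i =
      ∑ i ∈ S, v i + (if i₁ ∈ S then 1 else 0) - (if i₂ ∈ S then 1 else 0) := by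
    intro S
    simp [eVec, Pi.single_apply, Finset.sum_add_distrib]
  apply mem_mink_of_int
  · intro i
    obtain ⟨n, hn⟩ := hint i
    refine ⟨n + (if i = i₁ then 1 else 0) - (if i = i₂ then 1 else 0), ?_⟩
    simp [eVec, Pi.single_apply, hn]
  · rw [key]
    simp [mink_sum F v hv]
  · intro S
    rw [key]
    have h1 := mink_lower F v hv S
    by_cases hS : (i₁ ∈ S ↔ i₂ ∈ S)
    · simp only [hS]
      linarith
    · have h2 := hst S hS
      choose n hn using hint
      have h3 : ∑ i ∈ S, v i = ((∑ i ∈ S, n i : ℤ) : ℝ) := by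
        push_cast
        exact Finset.sum_congr rfl (fun i _ => hn i)
      rw [h3] at h2 ⊢
      have h4 : ((Finset.univ.filter (fun j => F j ⊆ S)).card : ℤ) + 1 ≤ ∑ i ∈ S, n i := by
        have : ((Finset.univ.filter (fun j => F j ⊆ S)).card : ℤ) < ∑ i ∈ S, n i := by
          exact_mod_cast h2
        omega
      have h5 : ((Finset.univ.filter (fun j => F j ⊆ S)).card : ℝ) + 1
          ≤ ((∑ i ∈ S, n i : ℤ) : ℝ) := by exact_mod_cast h4
      split_ifs <;> linarith

/-- If `v` is an integer point of `P_𝓕` that is not a vertex, and some edge of the smallest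
face of `P_𝓕` containing `v` is parallel to `e_{i₁} − e_{i₂}`, then both
`v + e_{i₁} − e_{i₂}` and `v − e_{i₁} + e_{i₂}` lie in `P_𝓕`. -/
theorem integer_point_moves_along_edge_direction {r k : ℕ} (F : Fin k → Finset (Fin r))
    (hF : ∀ j, (F j).Nonempty) (v : Fin r → ℝ) (hv : v ∈ mink F)
    (hint : ∀ i, ∃ n : ℤ, v i = n) (hnv : v ∉ Set.extremePoints ℝ (mink F))
    (i₁ i₂ : Fin r) (hne : i₁ ≠ i₂)
    (hedge : ∃ u w : Fin r → ℝ,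
      IsEdgeOf (⋂₀ {A : Set (Fin r → ℝ) | IsExtreme ℝ (mink F) A ∧ v ∈ A}) u w ∧
      ∃ α : ℝ, α ≠ 0 ∧ w - u = α • (eVec r i₁ - eVec r i₂)) :
    v + eVec r i₁ - eVec r i₂ ∈ mink F ∧ v - eVec r i₁ + eVec r i₂ ∈ mink F := by
  have hst := strict_of_sep F v hv i₁ i₂ hedge
  refine ⟨move_mem F v hv hint i₁ i₂ hst, ?_⟩
  have h := move_mem F v hv hint i₂ i₁ (fun S hS => hst S (fun hh => hS hh.symm))
  have e : v - eVec r i₁ + eVec r i₂ = v + eVec r i₂ - eVec r i₁ := by abel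
  rw [e]
  exact h
end

section
/- Let 𝓕 = (F_1,…,F_k) be a finite family of nonempty subsets of [r] and let u be a vertex of P = P_𝓕. Define a directed graph G⃗(u) on the vertex set [r] by putting a directed edge (i,j) whenever there exists α > 0 such that u + α(e_i − e_j) is a vertex of P and the segment [u, u + α(e_i − e_j)] is an edge of P. Then G⃗(u) is acyclic (in particular it contains no directed 2-cycles, so the underlying undirected graph is simple), and the underlying undirected graph of G⃗(u) contains no triangles. -/
open Pointwise

theorem mink_convex {r k : ℕ} (F : Fin k → Finset (Fin r)) : Convex ℝ (mink F) := by
  unfold mink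
  refine convex_sum _ fun j _ => ?_
  rintro x ⟨hx0, hxF, hx1⟩ y ⟨hy0, hyF, hy1⟩ a b ha hb hab
  refine ⟨fun i => ?_, fun i hi => ?_, ?_⟩
  · have := hx0 i
    have := hy0 i
    simp only [Pi.add_apply, Pi.smul_apply, smul_eq_mul]
    positivity
  · simp [hxF i hi, hyF i hi]
  · simp only [Pi.add_apply, Pi.smul_apply, smul_eq_mul, Finset.sum_add_distrib,
      ← Finset.mul_sum, hx1, hy1]
    linarith

theorem no_cycle_aux {r : ℕ} {P : Set (Fin r → ℝ)} (hP : Convex ℝ P) {u : Fin r → ℝ}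
    (hu : u ∈ Set.extremePoints ℝ P) (m : ℕ) (c : ℕ → Fin r) (hm : 0 < m) (hc : c 0 = c m)
    (h : ∀ l < m, ∃ α : ℝ, 0 < α ∧ IsEdgeOf P u (u + α • (eVec r (c l) - eVec r (c (l + 1))))) :
    False := by
  choose! α hα hE using h
  have hconv := (hP.mem_extremePoints_iff_convex_diff.1 hu).2
  have hpos : 0 < ∑ l ∈ Finset.range m, (α l)⁻¹ :=
    Finset.sum_pos (fun l hl => inv_pos.2 (hα l (Finset.mem_range.1 hl)))
      ⟨0, Finset.mem_range.2 hm⟩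
  have hmem := hconv.centerMass_mem (t := Finset.range m) (w := fun l => (α l)⁻¹)
    (z := fun l => u + α l • (eVec r (c l) - eVec r (c (l + 1))))
    (fun l hl => (inv_pos.2 (hα l (Finset.mem_range.1 hl))).le) hpos
    (fun l hl => by
      obtain ⟨hne, -, hv, -⟩ := hE l (Finset.mem_range.1 hl)
      exact ⟨hv.1, fun h => hne h.symm⟩)
  apply hmem.2
  have hsum : ∑ l ∈ Finset.range m, (α l)⁻¹ • (u + α l • (eVec r (c l) - eVec r (c (l + 1))))
      = (∑ l ∈ Finset.range m, (α l)⁻¹) • u := by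
    have : ∀ l ∈ Finset.range m,
        (α l)⁻¹ • (u + α l • (eVec r (c l) - eVec r (c (l + 1))))
          = (α l)⁻¹ • u + (eVec r (c l) - eVec r (c (l + 1))) := by
      intro l hl
      rw [smul_add, smul_smul, inv_mul_cancel₀ (hα l (Finset.mem_range.1 hl)).ne', one_smul]
    rw [Finset.sum_congr rfl this, Finset.sum_add_distrib, ← Finset.sum_smul,
      Finset.sum_range_sub' (fun l => eVec r (c l)), hc, sub_self, add_zero]
  rw [Set.mem_singleton_iff, Finset.centerMass, hsum, smul_smul, inv_mul_cancel₀ hpos.ne', one_smul]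

theorem shrink_aux {r : ℕ} {P : Set (Fin r → ℝ)} (hP : Convex ℝ P) {u d : Fin r → ℝ}
    (hu : u ∈ P) {α t : ℝ} (ht : 0 < t) (hta : t ≤ α) (h : u + α • d ∈ P) : u + t • d ∈ P := by
  have hα : 0 < α := ht.trans_le hta
  have := hP.add_smul_mem hu h (t := t / α) ⟨by positivity, (div_le_one hα).2 hta⟩
  rwa [smul_smul, div_mul_cancel₀ _ hα.ne'] at this

theorem no_trans_aux {r : ℕ} {P : Set (Fin r → ℝ)} (hP : Convex ℝ P) {u : Fin r → ℝ}
    (a b c : Fin r) (hab : a ≠ b) (hbc : b ≠ c)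
    (h1 : ∃ α : ℝ, 0 < α ∧ IsEdgeOf P u (u + α • (eVec r a - eVec r b)))
    (h2 : ∃ α : ℝ, 0 < α ∧ IsEdgeOf P u (u + α • (eVec r b - eVec r c)))
    (h3 : ∃ α : ℝ, 0 < α ∧ IsEdgeOf P u (u + α • (eVec r a - eVec r c))) : False := by
  obtain ⟨α, hα, -, hu, hv1, -⟩ := h1
  obtain ⟨β, hβ, -, -, hv2, -⟩ := h2
  obtain ⟨γ, hγ, -, -, -, hext⟩ := h3
  obtain ⟨t, ht, hta, htb, htc⟩ : ∃ t : ℝ, 0 < t ∧ t ≤ α ∧ t ≤ β ∧ t ≤ γ :=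
    ⟨min α (min β γ), by positivity, by simp, by simp, by simp⟩
  have m1 := shrink_aux hP hu.1 ht hta hv1.1
  have m2 := shrink_aux hP hu.1 ht htb hv2.1
  have hx : u + (t / 2) • (eVec r a - eVec r c) ∈
      segment ℝ u (u + γ • (eVec r a - eVec r c)) := by
    rw [segment_eq_image']
    refine ⟨t / 2 / γ, ⟨by positivity, (div_le_one hγ).2 (by linarith)⟩, ?_⟩
    simp only [add_sub_cancel_left, smul_smul]
    rw [div_mul_cancel₀ _ hγ.ne']
  have ho : u + (t / 2) • (eVec r a - eVec r c) ∈
      openSegment ℝ (u + t • (eVec r a - eVec r b)) (u + t • (eVec r b - eVec r c)) := by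
    refine ⟨1 / 2, 1 / 2, by norm_num, by norm_num, by norm_num, ?_⟩
    module
  have hs := hext.left_mem_of_mem_openSegment m1 m2 hx ho
  rw [segment_eq_image'] at hs
  obtain ⟨s, -, hs⟩ := hs
  have hb := congrFun hs b
  simp [eVec, Pi.single_apply, hab.symm, hbc] at hb
  linarith

/-- For a vertex `u` of `P = P_𝓕`, the directed graph `G⃗(u)` on `[r]` with an edge
`(i,j)` whenever `u + α(e_i − e_j)` is the other endpoint of an edge of `P` at `u` for
some `α > 0`, is acyclic (in particular it has no directed 2-cycles, so its underlying
graph is simple), and its underlying undirected graph has no triangles. -/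
theorem digraph_at_vertex_acyclic_and_triangle_free {r k : ℕ}
    (F : Fin k → Finset (Fin r)) (hF : ∀ j, (F j).Nonempty)
    (u : Fin r → ℝ) (hu : u ∈ Set.extremePoints ℝ (mink F)) :
    let Adj : Fin r → Fin r → Prop := fun i j =>
      ∃ α : ℝ, 0 < α ∧ IsEdgeOf (mink F) u (u + α • (eVec r i - eVec r j))
    (¬ ∃ (m : ℕ) (c : ℕ → Fin r), 0 < m ∧ c 0 = c m ∧ ∀ l < m, Adj (c l) (c (l + 1))) ∧
    (∀ i j l : Fin r, i ≠ j → j ≠ l → i ≠ l →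
      ¬ ((Adj i j ∨ Adj j i) ∧ (Adj j l ∨ Adj l j) ∧ (Adj i l ∨ Adj l i))) := by
  intro Adj
  have hP := mink_convex F
  have hcyc : ¬ ∃ (m : ℕ) (c : ℕ → Fin r), 0 < m ∧ c 0 = c m ∧
      ∀ l < m, Adj (c l) (c (l + 1)) := by
    rintro ⟨m, c, hm, hc, h⟩
    exact no_cycle_aux hP hu m c hm hc h
  have htr : ∀ a b c : Fin r, a ≠ b → b ≠ c → Adj a b → Adj b c → Adj a c → False :=
    fun a b c hab hbc h1 h2 h3 => no_trans_aux hP a b c hab hbc h1 h2 h3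
  have h3 : ∀ a b c : Fin r, Adj a b → Adj b c → Adj c a → False := by
    intro a b c h1 h2 h3
    refine hcyc ⟨3, fun n => if n = 1 then b else if n = 2 then c else a, by norm_num,
      by simp, ?_⟩
    intro l hl
    interval_cases l
    · simpa using h1
    · simpa using h2
    · simpa using h3
  refine ⟨hcyc, ?_⟩
  rintro i j l hij hjl hil ⟨h1 | h1, h2 | h2, h4 | h4⟩
  · exact htr i j l hij hjl h1 h2 h4
  · exact h3 i j l h1 h2 h4
  · exact htr i l j hil hjl.symm h4 h2 h1
  · exact htr l i j hil.symm hij h4 h1 h2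
  · exact htr j i l hij.symm hil h1 h4 h2
  · exact htr j l i hjl hil.symm h2 h4 h1
  · exact h3 i l j h4 h2 h1
  · exact htr l j i hjl.symm hij.symm h2 h1 h4
end

section
/- Let r ∈ ℕ, 1 ≤ k ≤ r, and for each i ∈ [k] let F_i = {i} ∪ {k+1, k+2, …, r}. Let P = P_𝓕 with 𝓕 = (F_1,…,F_k). Then v = e_1 + e_2 + ⋯ + e_k is a vertex of P, and for every i_2 ∈ [k] and every i_1 with k+1 ≤ i_1 ≤ r, the point v + e_{i_1} − e_{i_2} is a vertex of P and the segment [v, v + e_{i_1} − e_{i_2}] is an edge of P. In particular, the degree of v in P is at least k(r − k). -/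
open Pointwise

namespace LB

/-- The vertex `v` in coordinates. -/
lemma v_apply {r k : ℕ} (hkr : k ≤ r) (m : Fin r) :
    (∑ i : Fin k, eVec r (Fin.castLE hkr i)) m = if (m : ℕ) < k then (1 : ℝ) else 0 := by
  rw [Finset.sum_apply]
  split_ifs with h
  · rw [Finset.sum_eq_single (⟨m, h⟩ : Fin k)]
    · simp [eVec]
    · intro b _ hb
      have : m ≠ Fin.castLE hkr b := by
        rintro rfl
        exact hb (by ext; simp)
      simp [eVec, this]
    · simp
  · refine Finset.sum_eq_zero fun b _ => ?_
    have : m ≠ Fin.castLE hkr b := by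
      rintro rfl
      exact h (by simp)
    simp [eVec, this]

/-- The family of index sets. -/
def fam {r k : ℕ} (hkr : k ≤ r) : Fin k → Finset (Fin r) := fun i =>
  insert (Fin.castLE hkr i) (Finset.univ.filter fun m : Fin r => k ≤ (m : ℕ))

lemma eVec_mem_simpl {r : ℕ} {F : Finset (Fin r)} {i : Fin r} (h : i ∈ F) :
    eVec r i ∈ simpl F := by
  refine ⟨fun j => ?_, fun j hj => ?_, ?_⟩
  · unfold eVec; rw [Pi.single_apply]; split_ifs <;> norm_num
  · have : j ≠ i := by rintro rfl; exact hj h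
    simp [eVec, this]
  · simp [eVec]

lemma simpl_eq {r : ℕ} (F : Finset (Fin r)) :
    simpl F = convexHull ℝ (eVec r '' (F : Set (Fin r))) := by
  apply Set.Subset.antisymm
  · rintro x ⟨h0, hF, h1⟩
    have hs : ∑ i ∈ F, x i = 1 := by
      rw [← h1]
      exact Finset.sum_subset (Finset.subset_univ _) (fun i _ hi => hF i hi)
    have hx : x = ∑ i ∈ F, x i • eVec r i := by
      ext j
      rw [Finset.sum_apply]
      by_cases hj : j ∈ F
      · rw [Finset.sum_eq_single j]
        · simp [eVec]
        · intro b _ hb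
          simp [eVec, hb.symm]
        · exact fun h => absurd hj h
      · rw [hF j hj]
        symm
        refine Finset.sum_eq_zero fun b hb => ?_
        have : j ≠ b := by rintro rfl; exact hj hb
        simp [eVec, this]
    rw [hx]
    refine (convex_convexHull ℝ _).sum_mem (fun i _ => h0 i) hs (fun i hi => ?_)
    exact subset_convexHull ℝ _ ⟨i, hi, rfl⟩
  · apply convexHull_min
    · rintro _ ⟨i, hi, rfl⟩
      exact eVec_mem_simpl hi
    · rintro x ⟨hx0, hxF, hx1⟩ y ⟨hy0, hyF, hy1⟩ a b ha hb hab
      refine ⟨fun i => ?_, fun i hi => ?_, ?_⟩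
      · have := hx0 i
        have := hy0 i
        simp only [Pi.add_apply, Pi.smul_apply, smul_eq_mul]
        positivity
      · simp [hxF i hi, hyF i hi]
      · simp only [Pi.add_apply, Pi.smul_apply, smul_eq_mul]
        rw [Finset.sum_add_distrib, ← Finset.mul_sum, ← Finset.mul_sum, hx1, hy1]
        linarith

lemma finite_ext {r k : ℕ} (F : Fin k → Finset (Fin r)) :
    (Set.extremePoints ℝ (mink F)).Finite := by
  have : mink F = convexHull ℝ (∑ j : Fin k, eVec r '' (F j : Set (Fin r))) := by
    rw [convexHull_sum]
    exact Finset.sum_congr rfl fun j _ => simpl_eq (F j)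
  rw [this]
  refine Set.Finite.subset ?_ extremePoints_convexHull_subset
  refine Finset.sum_induction _ Set.Finite (fun a b ha hb => ha.add hb) Set.finite_zero ?_
  intro j _
  exact (Finset.finite_toSet _).image _

lemma mink_props {r k : ℕ} (hkr : k ≤ r) {x : Fin r → ℝ} (hx : x ∈ mink (fam hkr)) :
    (∀ m, 0 ≤ x m) ∧ (∀ m : Fin r, (m : ℕ) < k → x m ≤ 1) ∧ ∑ m, x m = k := by
  obtain ⟨g, hg, rfl⟩ := (Set.mem_fintype_sum _ _).1 hx
  refine ⟨fun m => ?_, fun m hm => ?_, ?_⟩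
  · rw [Finset.sum_apply]
    exact Finset.sum_nonneg fun j _ => (hg j).1 m
  · rw [Finset.sum_apply, Finset.sum_eq_single (⟨m, hm⟩ : Fin k)]
    · rw [← (hg ⟨m, hm⟩).2.2]
      exact Finset.single_le_sum (f := g ⟨m, hm⟩) (fun j _ => (hg _).1 j) (Finset.mem_univ m)
    · intro b _ hb
      refine (hg b).2.1 m ?_
      simp only [fam, Finset.mem_insert, Finset.mem_filter, Finset.mem_univ, true_and, not_or]
      refine ⟨?_, by omega⟩
      rintro rfl
      exact hb (by ext; simp)
    · simp
  · simp only [Finset.sum_apply]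
    rw [Finset.sum_comm]
    simp [fun j => (hg j).2.2]

lemma v_mem {r k : ℕ} (hkr : k ≤ r) :
    ∑ i : Fin k, eVec r (Fin.castLE hkr i) ∈ mink (fam hkr) :=
  (Set.mem_fintype_sum _ _).2
    ⟨fun i => eVec r (Fin.castLE hkr i), fun i => eVec_mem_simpl (by simp [fam]), rfl⟩

lemma w_mem {r k : ℕ} (hkr : k ≤ r) (i₂ : Fin k) (i₁ : Fin r) (h : k ≤ (i₁ : ℕ)) :
    ∑ i : Fin k, eVec r (Fin.castLE hkr i) + eVec r i₁ - eVec r (Fin.castLE hkr i₂)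
      ∈ mink (fam hkr) := by
  refine (Set.mem_fintype_sum _ _).2
    ⟨fun i => if i = i₂ then eVec r i₁ else eVec r (Fin.castLE hkr i), fun i => ?_, ?_⟩
  · dsimp only
    split_ifs with hi
    · exact eVec_mem_simpl (by simp [fam, h])
    · exact eVec_mem_simpl (by simp [fam])
  · rw [← Finset.add_sum_erase _ _ (Finset.mem_univ i₂),
      ← Finset.add_sum_erase _ (fun i => eVec r (Fin.castLE hkr i)) (Finset.mem_univ i₂),
      Finset.sum_congr rfl (g := fun i => eVec r (Fin.castLE hkr i))]
    · simp only [if_true]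
      abel
    · intro i hi
      simp [Finset.ne_of_mem_erase hi]

lemma v_unique {r k : ℕ} (hkr : k ≤ r) {x : Fin r → ℝ} (hx : x ∈ mink (fam hkr))
    (h1 : ∀ m : Fin r, (m : ℕ) < k → x m = 1) (h0 : ∀ m : Fin r, k ≤ (m : ℕ) → x m = 0) :
    x = ∑ i : Fin k, eVec r (Fin.castLE hkr i) := by
  ext m
  rw [v_apply]
  split_ifs with h
  · exact h1 m h
  · exact h0 m (by omega)

/-- A point on the face is on the line. -/
lemma line {r k : ℕ} (hkr : k ≤ r) (i₂ : Fin k) (i₁ : Fin r) (h : k ≤ (i₁ : ℕ))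
    {x : Fin r → ℝ} (hx : x ∈ mink (fam hkr))
    (h1 : ∀ m : Fin r, (m : ℕ) < k → m ≠ Fin.castLE hkr i₂ → x m = 1)
    (h0 : ∀ m : Fin r, k ≤ (m : ℕ) → m ≠ i₁ → x m = 0) :
    x = ∑ i : Fin k, eVec r (Fin.castLE hkr i) +
      x i₁ • (eVec r i₁ - eVec r (Fin.castLE hkr i₂)) ∧
      x i₁ + x (Fin.castLE hkr i₂) = 1 := by
  have hne : i₁ ≠ Fin.castLE hkr i₂ := by
    rintro rfl
    have := i₂.2
    simp at h
    omega
  have hs := (mink_props hkr hx).2.2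
  have hv := (mink_props hkr (v_mem hkr)).2.2
  have hi2 : ((Fin.castLE hkr i₂ : Fin r) : ℕ) < k := by simp
  have hsum : x i₁ + x (Fin.castLE hkr i₂) = 1 := by
    have e1 : ∑ m, (x m - (∑ i : Fin k, eVec r (Fin.castLE hkr i)) m) = 0 := by
      rw [Finset.sum_sub_distrib, hs, hv, sub_self]
    rw [Finset.sum_eq_add i₁ (Fin.castLE hkr i₂) hne] at e1
    · rw [v_apply, v_apply, if_neg (by omega), if_pos hi2] at e1
      linarith
    · rintro c _ ⟨hc1, hc2⟩
      rw [v_apply]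
      split_ifs with hc
      · rw [h1 c hc hc2, sub_self]
      · rw [h0 c (by omega) hc1, sub_self]
    · simp
    · simp
  refine ⟨?_, hsum⟩
  ext m
  simp only [Pi.add_apply, Pi.smul_apply, Pi.sub_apply, smul_eq_mul]
  rw [v_apply]
  by_cases hm1 : m = i₁
  · subst hm1
    simp [eVec, hne, h]
  by_cases hm2 : m = Fin.castLE hkr i₂
  · subst hm2
    rw [if_pos hi2]
    simp [eVec, hne.symm]
    linarith
  simp only [eVec, Pi.single_apply, hm1, hm2, if_false]
  split_ifs with hc
  · rw [h1 m hc hm2]; ring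
  · rw [h0 m (by omega) hm1]; ring

lemma zero_of {a b p q : ℝ} (ha : 0 < a) (hb : 0 < b) (hp : 0 ≤ p) (hq : 0 ≤ q)
    (h : a * p + b * q = 0) : p = 0 := by
  by_contra hne
  have : 0 < p := lt_of_le_of_ne hp (Ne.symm hne)
  have := mul_pos ha this
  have := mul_nonneg hb.le hq
  linarith

lemma one_of {a b p q : ℝ} (ha : 0 < a) (hb : 0 < b) (hab : a + b = 1) (hp : p ≤ 1) (hq : q ≤ 1)
    (h : a * p + b * q = 1) : p = 1 := by
  have := zero_of (p := 1 - p) (q := 1 - q) ha hb (by linarith) (by linarith) (by linarith)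
  linarith

lemma v_ext {r k : ℕ} (hkr : k ≤ r) :
    ∑ i : Fin k, eVec r (Fin.castLE hkr i) ∈ Set.extremePoints ℝ (mink (fam hkr)) := by
  rw [mem_extremePoints_iff_left]
  refine ⟨v_mem hkr, ?_⟩
  rintro x hx y hy ⟨a, b, ha, hb, hab, hz⟩
  obtain ⟨px0, px1, -⟩ := mink_props hkr hx
  obtain ⟨py0, py1, -⟩ := mink_props hkr hy
  have hc : ∀ m, a * x m + b * y m = if (m : ℕ) < k then (1 : ℝ) else 0 := by
    intro m
    rw [← v_apply hkr, ← hz]; rfl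
  refine v_unique hkr hx (fun m hm => ?_) (fun m hm => ?_)
  · exact one_of ha hb hab (px1 m hm) (py1 m hm) (by rw [hc, if_pos hm])
  · exact zero_of ha hb (px0 m) (py0 m) (by rw [hc, if_neg (by omega)])

/-- Coordinates of points on the candidate edge. -/
lemma edge_coord {r k : ℕ} (hkr : k ≤ r) (i₂ : Fin k) (i₁ : Fin r) (t : ℝ) (m : Fin r)
    (hm2 : m ≠ Fin.castLE hkr i₂) (hm1 : m ≠ i₁) :
    (∑ i : Fin k, eVec r (Fin.castLE hkr i) +
      t • (eVec r i₁ - eVec r (Fin.castLE hkr i₂))) m = if (m : ℕ) < k then (1 : ℝ) else 0 := by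
  rw [Pi.add_apply, v_apply]
  simp [eVec, hm1, hm2]

/-- Face property: endpoints of open segments meeting the line lie on the line. -/
lemma face {r k : ℕ} (hkr : k ≤ r) (i₂ : Fin k) (i₁ : Fin r) (h : k ≤ (i₁ : ℕ))
    {x y : Fin r → ℝ} (hx : x ∈ mink (fam hkr)) (hy : y ∈ mink (fam hkr)) {t : ℝ}
    (hz : ∑ i : Fin k, eVec r (Fin.castLE hkr i) +
      t • (eVec r i₁ - eVec r (Fin.castLE hkr i₂)) ∈ openSegment ℝ x y) :
    x = ∑ i : Fin k, eVec r (Fin.castLE hkr i) +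
      x i₁ • (eVec r i₁ - eVec r (Fin.castLE hkr i₂)) ∧
      x i₁ + x (Fin.castLE hkr i₂) = 1 := by
  obtain ⟨a, b, ha, hb, hab, hz⟩ := hz
  obtain ⟨px0, px1, -⟩ := mink_props hkr hx
  obtain ⟨py0, py1, -⟩ := mink_props hkr hy
  have hc : ∀ m, m ≠ Fin.castLE hkr i₂ → m ≠ i₁ →
      a * x m + b * y m = if (m : ℕ) < k then (1 : ℝ) else 0 := by
    intro m hm2 hm1
    rw [← edge_coord hkr i₂ i₁ t m hm2 hm1, ← hz]; rfl
  refine line hkr i₂ i₁ h hx (fun m hm hne => ?_) (fun m hm hne => ?_)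
  · have : m ≠ i₁ := by rintro rfl; omega
    exact one_of ha hb hab (px1 m hm) (py1 m hm) (by rw [hc m hne this, if_pos hm])
  · have : m ≠ Fin.castLE hkr i₂ := by
      rintro rfl
      have := i₂.2
      simp at hm
      omega
    exact zero_of ha hb (px0 m) (py0 m) (by rw [hc m this hne, if_neg (by omega)])

lemma w_ext {r k : ℕ} (hkr : k ≤ r) (i₂ : Fin k) (i₁ : Fin r) (h : k ≤ (i₁ : ℕ)) :
    ∑ i : Fin k, eVec r (Fin.castLE hkr i) + eVec r i₁ - eVec r (Fin.castLE hkr i₂)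
      ∈ Set.extremePoints ℝ (mink (fam hkr)) := by
  rw [mem_extremePoints_iff_left]
  refine ⟨w_mem hkr i₂ i₁ h, ?_⟩
  intro x hx y hy hz
  have hne : Fin.castLE hkr i₂ ≠ i₁ := by
    rintro rfl
    have := i₂.2
    simp at h
    omega
  obtain ⟨hxl, hxs⟩ := face hkr i₂ i₁ h hx hy (t := 1) (by rwa [one_smul, ← add_sub_assoc])
  obtain ⟨a, b, ha, hb, hab, hz⟩ := hz
  have h2 : x (Fin.castLE hkr i₂) = 0 := by
    refine zero_of ha hb ((mink_props hkr hx).1 _) ((mink_props hkr hy).1 (Fin.castLE hkr i₂)) ?_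
    have := congrFun hz (Fin.castLE hkr i₂)
    rw [Pi.sub_apply, Pi.add_apply, Pi.add_apply, v_apply, if_pos (by simp)] at this
    simpa [eVec, hne] using this
  have h3 : x i₁ = 1 := by linarith
  rw [hxl, h3, one_smul, ← add_sub_assoc]

lemma edge {r k : ℕ} (hkr : k ≤ r) (i₂ : Fin k) (i₁ : Fin r) (h : k ≤ (i₁ : ℕ)) :
    IsEdgeOf (mink (fam hkr)) (∑ i : Fin k, eVec r (Fin.castLE hkr i))
      (∑ i : Fin k, eVec r (Fin.castLE hkr i) + eVec r i₁ - eVec r (Fin.castLE hkr i₂)) := by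
  have hne : i₁ ≠ Fin.castLE hkr i₂ := by
    rintro rfl
    have := i₂.2
    simp at h
    omega
  have hconv : Convex ℝ (mink (fam hkr)) := by
    have : mink (fam hkr) = convexHull ℝ (∑ j : Fin k, eVec r '' (fam hkr j : Set (Fin r))) := by
      rw [convexHull_sum]
      exact Finset.sum_congr rfl fun j _ => simpl_eq _
    rw [this]
    exact convex_convexHull ℝ _
  refine ⟨?_, v_ext hkr, w_ext hkr i₂ i₁ h, hconv.segment_subset (v_mem hkr) (w_mem hkr i₂ i₁ h), ?_⟩
  · intro he
    have := congrFun he i₁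
    rw [Pi.sub_apply, Pi.add_apply] at this
    simp [eVec, hne] at this
  · intro x hx y hy z hz hzo
    rw [segment_eq_image'] at hz ⊢
    obtain ⟨t, -, rfl⟩ := hz
    have e : ∑ i : Fin k, eVec r (Fin.castLE hkr i) + eVec r i₁ - eVec r (Fin.castLE hkr i₂)
        - ∑ i : Fin k, eVec r (Fin.castLE hkr i) = eVec r i₁ - eVec r (Fin.castLE hkr i₂) := by
      abel
    rw [e] at hzo ⊢
    obtain ⟨hxl, hxs⟩ := face hkr i₂ i₁ h hx hy hzo
    have p0 := (mink_props hkr hx).1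
    exact ⟨x i₁, ⟨p0 _, by linarith [p0 (Fin.castLE hkr i₂)]⟩, hxl.symm⟩

lemma deg {r k : ℕ} (hkr : k ≤ r) :
    k * (r - k) ≤ polyDeg (mink (fam hkr)) (∑ i : Fin k, eVec r (Fin.castLE hkr i)) := by
  let idx : Fin (r - k) → Fin r := fun j => ⟨k + j, by omega⟩
  let φ : Fin k × Fin (r - k) → (Fin r → ℝ) := fun p =>
    ∑ i : Fin k, eVec r (Fin.castLE hkr i) + eVec r (idx p.2) - eVec r (Fin.castLE hkr p.1)
  have hlt : ∀ (i : Fin k) (j : Fin (r - k)), idx j ≠ Fin.castLE hkr i := by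
    intro i j hij
    have := congrArg Fin.val hij
    simp [idx] at this
    omega
  have hinj : Function.Injective φ := by
    rintro ⟨i, j⟩ ⟨i', j'⟩ he
    have he' : eVec r (idx j) - eVec r (Fin.castLE hkr i)
        = eVec r (idx j') - eVec r (Fin.castLE hkr i') := by
      simpa [φ, add_sub_assoc] using he
    have c1 := congrFun he' (idx j)
    have c2 := congrFun he' (Fin.castLE hkr i)
    have hj : idx j = idx j' := by
      by_contra hn
      simp [eVec, hlt, hn] at c1
    have hi : Fin.castLE hkr i = Fin.castLE hkr i' := by
      by_contra hn
      rw [hj] at c2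
      simp [eVec, Pi.single_apply] at c2
      exact hn (by rw [c2])
    have hi' : i = i' := by
      have := congrArg Fin.val hi
      ext; simpa using this
    have hj' : j = j' := by
      have := congrArg Fin.val hj
      ext; simpa [idx] using this
    rw [hi', hj']
  have hcard : (φ '' Set.univ).ncard = k * (r - k) := by
    rw [Set.ncard_image_of_injective _ hinj, Set.ncard_univ]
    simp
  unfold polyDeg
  rw [← hcard]
  refine Set.ncard_le_ncard ?_ ((finite_ext (fam hkr)).subset fun w hw => hw.2.2.1)
  rintro _ ⟨⟨i, j⟩, -, rfl⟩
  exact edge hkr i (idx j) (by simp [idx])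

end LB

/-- For the family `F i = {i} ∪ {k+1,…,r}` (`i ∈ [k]`, written 0-indexed in `Fin r`),
the point `v = e_1 + ⋯ + e_k` is a vertex of `P = P_𝓕`; for every `i₂ ∈ [k]` and every
`i₁ ∈ {k+1,…,r}` the point `v + e_{i₁} − e_{i₂}` is a vertex of `P` and
`[v, v + e_{i₁} − e_{i₂}]` is an edge of `P`; in particular `deg(v) ≥ k(r − k)`. -/
theorem lower_bound_example_degree {r k : ℕ} (hk1 : 1 ≤ k) (hkr : k ≤ r) :
    let F : Fin k → Finset (Fin r) := fun i =>
      insert (Fin.castLE hkr i) (Finset.univ.filter fun m : Fin r => k ≤ (m : ℕ))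
    let v : Fin r → ℝ := ∑ i : Fin k, eVec r (Fin.castLE hkr i)
    v ∈ Set.extremePoints ℝ (mink F) ∧
    (∀ i₂ : Fin k, ∀ i₁ : Fin r, k ≤ (i₁ : ℕ) →
      (v + eVec r i₁ - eVec r (Fin.castLE hkr i₂)) ∈ Set.extremePoints ℝ (mink F) ∧
      IsEdgeOf (mink F) v (v + eVec r i₁ - eVec r (Fin.castLE hkr i₂))) ∧
    k * (r - k) ≤ polyDeg (mink F) v := by
  intro F v
  exact ⟨LB.v_ext hkr, fun i₂ i₁ h => ⟨LB.w_ext hkr i₂ i₁ h, LB.edge hkr i₂ i₁ h⟩, LB.deg hkr⟩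
end

section
/- Let n ∈ ℕ and 1 ≤ k ≤ n/2. If G is a simple graph on n vertices that is triangle-free and has a vertex cover of cardinality at most k, then G has at most k(n − k) edges. -/
/-- Mantel-type bound: a triangle-free simple graph on `n` vertices with a vertex cover of
cardinality at most `k`, where `1 ≤ k ≤ n/2`, has at most `k(n − k)` edges. -/
theorem mantel_variant_bound {V : Type*} [Fintype V] (n k : ℕ)
    (hn : Fintype.card V = n) (hk1 : 1 ≤ k) (hk2 : 2 * k ≤ n)
    (G : SimpleGraph V)
    (htri : ∀ a b c : V, G.Adj a b → G.Adj b c → G.Adj a c → False)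
    (C : Finset V) (hC : ∀ a b : V, G.Adj a b → a ∈ C ∨ b ∈ C) (hCk : C.card ≤ k) :
    G.edgeSet.ncard ≤ k * (n - k) := by
  classical
  obtain ⟨D, hD, hmin⟩ := Finset.exists_min_image
    (Finset.univ.filter fun D : Finset V => ∀ a b : V, G.Adj a b → a ∈ D ∨ b ∈ D)
    Finset.card ⟨C, by simpa using hC⟩
  simp only [Finset.mem_filter, Finset.mem_univ, true_and] at hD hmin
  have hDk : D.card ≤ k := (hmin C hC).trans hCk
  have hdeg : ∀ v, G.degree v ≤ n - D.card := by
    intro v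
    have h1 := hmin (G.neighborFinset v)ᶜ (by
      intro a b hab
      simp only [Finset.mem_compl, SimpleGraph.mem_neighborFinset]
      by_contra! h
      exact htri v a b h.1 hab h.2)
    have h2 := Finset.card_add_card_compl (G.neighborFinset v)
    rw [SimpleGraph.card_neighborFinset_eq_degree] at h2
    omega
  have hsub : G.edgeFinset ⊆ D.biUnion fun v => G.incidenceFinset v := by
    intro e he
    induction e using Sym2.ind with
    | _ a b =>
      rw [SimpleGraph.mem_edgeFinset, SimpleGraph.mem_edgeSet] at he
      simp only [Finset.mem_biUnion, SimpleGraph.mem_incidenceFinset]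
      rcases hD a b he with h | h
      · exact ⟨a, h, he, by simp⟩
      · exact ⟨b, h, he, by simp⟩
  have hle : G.edgeFinset.card ≤ D.card * (n - D.card) :=
    (Finset.card_le_card hsub).trans (Finset.card_biUnion_le_card_mul _ _ _ fun v _ => by
      rw [SimpleGraph.card_incidenceFinset_eq_degree]; exact hdeg v)
  rw [← SimpleGraph.coe_edgeFinset, Set.ncard_coe_finset]
  refine hle.trans ?_
  obtain ⟨j, hj⟩ := Nat.exists_eq_add_of_le hDk
  obtain ⟨r, hr⟩ := Nat.exists_eq_add_of_le hk2
  have e1 : n - D.card = D.card + 2 * j + r := by omega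
  have e2 : n - k = D.card + j + r := by omega
  rw [e1, e2, hj]
  nlinarith [Nat.zero_le (j * j), Nat.zero_le (j * r)]
end

section
/- Let n ∈ ℕ and 1 ≤ k ≤ n/2. If G is a simple graph on n vertices that is triangle-free, has a vertex cover of cardinality at most k, and has exactly k(n − k) edges, then G is a complete bipartite graph with parts of cardinalities k and n − k; that is, the vertex set of G can be partitioned into sets A and B with |A| = k and |B| = n − k such that two vertices are adjacent in G if and only if one lies in A and the other in B. -/
/-- Equality case of the Mantel-type bound: a triangle-free simple graph on `n` vertices
with a vertex cover of cardinality at most `k` (`1 ≤ k ≤ n/2`) and exactly `k(n − k)`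
edges is a complete bipartite graph with parts of cardinalities `k` and `n − k`. -/
theorem mantel_variant_equality {V : Type*} [Fintype V] [DecidableEq V] (n k : ℕ)
    (hn : Fintype.card V = n) (hk1 : 1 ≤ k) (hk2 : 2 * k ≤ n)
    (G : SimpleGraph V)
    (htri : ∀ a b c : V, G.Adj a b → G.Adj b c → G.Adj a c → False)
    (C : Finset V) (hC : ∀ a b : V, G.Adj a b → a ∈ C ∨ b ∈ C) (hCk : C.card ≤ k)
    (hedges : G.edgeSet.ncard = k * (n - k)) :
    ∃ A B : Finset V, Disjoint A B ∧ A ∪ B = Finset.univ ∧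
      A.card = k ∧ B.card = n - k ∧
      ∀ a b : V, G.Adj a b ↔ (a ∈ A ∧ b ∈ B) ∨ (a ∈ B ∧ b ∈ A) := by
  classical
  -- a maximum independent set
  obtain ⟨S, hS, hmax⟩ := Finset.exists_max_image
    (Finset.univ.filter fun S : Finset V => ∀ a ∈ S, ∀ b ∈ S, ¬ G.Adj a b) Finset.card
    ⟨Cᶜ, by
      simp only [Finset.mem_filter, Finset.mem_univ, true_and, Finset.mem_compl]
      intro a ha b hb hab
      rcases hC a b hab with h | h
      · exact ha h
      · exact hb h⟩
  simp only [Finset.mem_filter, Finset.mem_univ, true_and] at hS hmax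
  have hCS : Cᶜ.card ≤ S.card := by
    apply hmax
    intro a ha b hb hab
    rw [Finset.mem_compl] at ha hb
    rcases hC a b hab with h | h
    · exact ha h
    · exact hb h
  have hdeg : ∀ v, (G.neighborFinset v).card ≤ S.card := by
    intro v
    apply hmax
    intro a ha b hb hab
    rw [SimpleGraph.mem_neighborFinset] at ha hb
    exact htri v a b ha hab hb
  have hcardS : S.card + Sᶜ.card = n := by rw [Finset.card_add_card_compl, hn]
  have hcardC : C.card + Cᶜ.card = n := by rw [Finset.card_add_card_compl, hn]
  -- degrees split along S and its complement
  have hsplit : ∀ v, ((G.neighborFinset v) ∩ S).card + ((G.neighborFinset v) ∩ Sᶜ).card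
      = G.degree v := by
    intro v
    rw [← SimpleGraph.card_neighborFinset_eq_degree, ← Finset.sdiff_eq_inter_compl]
    exact Finset.card_inter_add_card_sdiff _ _
  have hsum := G.sum_degrees_eq_twice_card_edges
  have he : G.edgeFinset.card = k * (n - k) := by
    rw [← hedges, ← SimpleGraph.coe_edgeFinset, Set.ncard_coe_finset]
  have hSsum : ∑ v ∈ S, G.degree v = ∑ v ∈ Sᶜ, ((G.neighborFinset v) ∩ S).card := by
    have h1 : ∀ v ∈ S, G.degree v = (Finset.bipartiteAbove G.Adj Sᶜ v).card := by
      intro v hv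
      rw [← SimpleGraph.card_neighborFinset_eq_degree]
      congr 1
      ext w
      simp only [SimpleGraph.mem_neighborFinset, Finset.bipartiteAbove, Finset.mem_filter,
        Finset.mem_compl]
      exact ⟨fun h => ⟨fun hw => hS v hv w hw h, h⟩, fun h => h.2⟩
    rw [Finset.sum_congr rfl h1, Finset.sum_card_bipartiteAbove_eq_sum_card_bipartiteBelow]
    apply Finset.sum_congr rfl
    intro v _
    congr 1
    ext w
    simp only [SimpleGraph.mem_neighborFinset, Finset.bipartiteBelow, Finset.mem_filter,
      Finset.mem_inter, G.adj_comm v w, and_comm]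
  have hdeg' : ∀ v, G.degree v ≤ S.card := fun v => by
    rw [← SimpleGraph.card_neighborFinset_eq_degree]; exact hdeg v
  have htot : ∑ v ∈ Sᶜ, (((G.neighborFinset v) ∩ S).card + G.degree v)
      = 2 * (k * (n - k)) := by
    rw [Finset.sum_add_distrib, ← hSsum, Finset.sum_add_sum_compl, hsum, he]
  have hle : ∀ v ∈ Sᶜ, ((G.neighborFinset v) ∩ S).card + G.degree v ≤ 2 * S.card := by
    intro v _
    have h1 := hsplit v
    have h2 := hdeg' v
    omega
  have hbound := Finset.sum_le_sum hle
  rw [htot, Finset.sum_const, smul_eq_mul] at hbound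
  obtain ⟨m, rfl⟩ : ∃ m, n = k + m := ⟨n - k, by omega⟩
  rw [Nat.add_sub_cancel_left] at *
  have htk : Sᶜ.card = k := by
    have h1 : Sᶜ.card ≤ k := by omega
    by_contra hne
    obtain ⟨d, hd⟩ : ∃ d, k = Sᶜ.card + (d + 1) := ⟨k - Sᶜ.card - 1, by omega⟩
    obtain ⟨r, hr⟩ : ∃ r, m = Sᶜ.card + (d + 1) + r := ⟨m - k, by omega⟩
    have hs : S.card = m + (d + 1) := by omega
    rw [hs] at hbound
    generalize Sᶜ.card = t at *
    subst hd
    subst hr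
    nlinarith [Nat.zero_le (d * d), Nat.zero_le (d * r)]
  have hSm : S.card = m := by omega
  have heq : ∀ v ∈ Sᶜ, ((G.neighborFinset v) ∩ S).card + G.degree v = 2 * S.card := by
    apply (Finset.sum_eq_sum_iff_of_le hle).1
    rw [htot, Finset.sum_const, smul_eq_mul, htk, hSm]
    ring
  have hfull : ∀ v ∈ Sᶜ, ∀ w ∈ S, G.Adj v w := by
    intro v hv w hw
    have h1 := heq v hv
    have h2 := hdeg' v
    have h3 : (G.neighborFinset v) ∩ S = S :=
      Finset.eq_of_subset_of_card_le Finset.inter_subset_right (by omega)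
    rw [← h3] at hw
    exact (G.mem_neighborFinset v w).1 (Finset.mem_inter.1 hw).1
  obtain ⟨s, hs⟩ : S.Nonempty := Finset.card_pos.1 (by omega)
  refine ⟨Sᶜ, S, disjoint_compl_left, by ext x; simp [em'], htk, hSm, ?_⟩
  intro a b
  constructor
  · intro hab
    by_cases ha : a ∈ S
    · by_cases hb : b ∈ S
      · exact (hS a ha b hb hab).elim
      · exact Or.inr ⟨ha, Finset.mem_compl.2 hb⟩
    · by_cases hb : b ∈ S
      · exact Or.inl ⟨Finset.mem_compl.2 ha, hb⟩
      · exact (htri a b s hab (hfull b (Finset.mem_compl.2 hb) s hs)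
          (hfull a (Finset.mem_compl.2 ha) s hs)).elim
  · rintro (⟨ha, hb⟩ | ⟨ha, hb⟩)
    · exact hfull a ha b hb
    · exact (hfull b hb a ha).symm
end
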